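/- arXiv:1805.04480 — 2 statements merged into one kernel-verified Lean document; each statement's English description precedes it below -/
import Mathlib

section
/- Let ξ₁, ξ₂ be real numbers such that {1, ξ₁, ξ₂} is linearly independent over ℚ. Then there exists a 3-system P = (P₁,P₂,P₃) and a constant C ≥ 0 such that |P_j(q) − L_j(q)| ≤ C for all q > 0 and all j ∈ {1,2,3}. -/
open Filter Pointwise

/-- The lattice `Λ = {(x, ξ₁x - y₁, ξ₂x - y₂) : x, y₁, y₂ ∈ ℤ} ⊆ ℝ³`. -/
def LatticeSet (ξ₁ ξ₂ : ℝ) : Set (Fin 3 → ℝ) :=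
  {p | ∃ x y₁ y₂ : ℤ, p 0 = (x : ℝ) ∧ p 1 = ξ₁ * x - y₁ ∧ p 2 = ξ₂ * x - y₂}

/-- The box `K(q) = {(z₀,z₁,z₂) : |z₀| ≤ e^{2q}, |z₁| ≤ e^{-q}, |z₂| ≤ e^{-q}}`. -/
def Box (q : ℝ) : Set (Fin 3 → ℝ) :=
  {z | |z 0| ≤ Real.exp (2 * q) ∧ |z 1| ≤ Real.exp (-q) ∧ |z 2| ≤ Real.exp (-q)}

/-- The `j`-th successive minimum `λ_j(q)` of `K(q)` with respect to `Λ`: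
the infimum of all `λ > 0` such that `λ·K(q)` contains `j` linearly independent
points of `Λ`. -/
noncomputable def lambdaMin (ξ₁ ξ₂ : ℝ) (j : ℕ) (q : ℝ) : ℝ :=
  sInf {l : ℝ | 0 < l ∧ ∃ v : Fin j → (Fin 3 → ℝ), LinearIndependent ℝ v ∧
    ∀ i, v i ∈ LatticeSet ξ₁ ξ₂ ∧ v i ∈ l • Box q}

/-- `L_j(q) = log λ_j(q)`. -/
noncomputable def Lmin (ξ₁ ξ₂ : ℝ) (j : ℕ) (q : ℝ) : ℝ :=
  Real.log (lambdaMin ξ₁ ξ₂ j q)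

/-- `φ̲_j = liminf_{q → ∞} L_j(q)/q`. -/
noncomputable def phiLow (ξ₁ ξ₂ : ℝ) (j : ℕ) : ℝ :=
  liminf (fun q : ℝ => Lmin ξ₁ ξ₂ j q / q) atTop

/-- `φ̄_j = limsup_{q → ∞} L_j(q)/q`. -/
noncomputable def phiUp (ξ₁ ξ₂ : ℝ) (j : ℕ) : ℝ :=
  limsup (fun q : ℝ => Lmin ξ₁ ξ₂ j q / q) atTop

/-- An `n`-system in the sense of Schmidt and Summerer: an `n`-tuple of continuous
piecewise linear functions on `[0,∞)`, vanishing at `0`, with all slopes among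
`{-(n-1), 1}`, ordered `P 0 ≤ P 1 ≤ ⋯`, summing to `0`, and satisfying the switch
condition: if at a switch point some `P i` changes from slope `-(n-1)` to slope `1`
and some `P j` changes from slope `1` to slope `-(n-1)`, then `i < j` unless the two
functions agree there. The piecewise linear structure is given by an unbounded
increasing sequence of breakpoints `t` with slopes `σ k j` on `[t k, t (k+1)]`. -/
def IsNSystem (n : ℕ) (P : Fin n → ℝ → ℝ) : Prop :=
  ∃ t : ℕ → ℝ, ∃ σ : ℕ → Fin n → ℝ,
    t 0 = 0 ∧ StrictMono t ∧ Filter.Tendsto t Filter.atTop Filter.atTop ∧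
    (∀ j, P j 0 = 0) ∧
    (∀ k j, σ k j = -((n : ℝ) - 1) ∨ σ k j = 1) ∧
    (∀ k, ∀ j, ∀ q ∈ Set.Icc (t k) (t (k + 1)), P j q = P j (t k) + σ k j * (q - t k)) ∧
    (∀ q, 0 ≤ q → ∀ i j : Fin n, i ≤ j → P i q ≤ P j q) ∧
    (∀ q, 0 ≤ q → ∑ j, P j q = 0) ∧
    (∀ k, ∀ i j : Fin n,
      σ k i = -((n : ℝ) - 1) → σ (k + 1) i = 1 → σ k j = 1 → σ (k + 1) j = -((n : ℝ) - 1) →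
      i < j ∨ P i (t (k + 1)) = P j (t (k + 1)))



/-- The largest row of the partition attached to a pair of target sequences `a`, `c`. -/
def topRow (a c : ℕ → ℤ) (k : ℕ) : ℤ := max (a k) (max ((k - c k + 1) / 2) (((k : ℤ) + 2) / 3))

/-- The smallest row of the partition attached to a pair of target sequences `a`, `c`. -/
def botRow (a c : ℕ → ℤ) (k : ℕ) : ℤ := min (c k) (min ((k - a k) / 2) ((k : ℤ) / 3))

/-- The partition of `k` into three rows attached to a pair of target sequences `a`, `c`. -/
def partRows (a c : ℕ → ℤ) (k : ℕ) : Fin 3 → ℤ :=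
  ![topRow a c k, k - topRow a c k - botRow a c k, botRow a c k]

/-- Target sequences for the extreme rows: both grow by at most one at each step, the first one
resumes growing only where it is dominated, the second one stops growing only where it dominates,
and both do not grow together unless one of these happens. -/
structure IsTarget (a c : ℕ → ℤ) : Prop where
  step_a : ∀ k, a (k + 1) = a k ∨ a (k + 1) = a k + 1
  step_c : ∀ k, c (k + 1) = c k ∨ c (k + 1) = c k + 1
  kink_a : ∀ k, a (k + 1) = a k → a (k + 2) = a (k + 1) + 1 → 2 * a (k + 1) + c (k + 1) < k + 1
  kink_c : ∀ k, c (k + 1) = c k + 1 → c (k + 2) = c (k + 1) →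
    k + 1 < a (k + 1) + 2 * c (k + 1)
  both : ∀ k, a (k + 1) = a k + 1 → c (k + 1) = c k + 1 →
    2 * a k + c k + 3 < k ∨ k + 3 < a k + 2 * c k
  zero_a : a 0 ≤ 0
  zero_c : 0 ≤ c 0

section
variable {a c : ℕ → ℤ}

lemma topRow_spec (a c : ℕ → ℤ) (k : ℕ) :
    a k ≤ topRow a c k ∧ k - c k ≤ 2 * topRow a c k ∧ k ≤ 3 * topRow a c k ∧
    (topRow a c k = a k ∨ 2 * topRow a c k ≤ k - c k + 1 ∨ 3 * topRow a c k ≤ k + 2) := by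
  unfold topRow; omega

lemma botRow_spec (a c : ℕ → ℤ) (k : ℕ) :
    botRow a c k ≤ c k ∧ 2 * botRow a c k ≤ k - a k ∧ 3 * botRow a c k ≤ k ∧
    (botRow a c k = c k ∨ k - a k ≤ 2 * botRow a c k + 1 ∨ k ≤ 3 * botRow a c k + 2) := by
  unfold botRow; omega

lemma le_topRow_topRow_botRow (a c : ℕ → ℤ) (k : ℕ) : k ≤ 2 * topRow a c k + botRow a c k := by
  have := topRow_spec a c k; have := botRow_spec a c k; omega

lemma topRow_botRow_botRow_le (a c : ℕ → ℤ) (k : ℕ) : topRow a c k + 2 * botRow a c k ≤ k := by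
  have := topRow_spec a c k; have := botRow_spec a c k; omega

lemma topRow_step (h : IsTarget a c) (k : ℕ) :
    topRow a c (k + 1) = topRow a c k ∨ topRow a c (k + 1) = topRow a c k + 1 := by
  have := h.step_a k; have := h.step_c k
  have := topRow_spec a c k; have := topRow_spec a c (k + 1); push_cast at *; omega

lemma botRow_step (h : IsTarget a c) (k : ℕ) :
    botRow a c (k + 1) = botRow a c k ∨ botRow a c (k + 1) = botRow a c k + 1 := by
  have := h.step_a k; have := h.step_c k
  have := botRow_spec a c k; have := botRow_spec a c (k + 1); push_cast at *; omega

lemma topRow_increase (h : IsTarget a c) (k : ℕ)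
    (h₁ : topRow a c (k + 1) = topRow a c k + 1) :
    (a (k + 1) = a k + 1 ∧ topRow a c k = a k) ∨
    (c (k + 1) = c k ∧ 2 * topRow a c k = k - c k) ∨ 3 * topRow a c k = k := by
  have := h.step_a k; have := h.step_c k
  have := topRow_spec a c k; have := topRow_spec a c (k + 1); push_cast at *; omega

lemma botRow_increase (h : IsTarget a c) (k : ℕ)
    (h₁ : botRow a c (k + 1) = botRow a c k + 1) :
    (c (k + 1) = c k + 1 ∧ botRow a c k = c k) ∨
    (a (k + 1) = a k ∧ 2 * botRow a c k + 1 = k - a k) ∨ 3 * botRow a c k + 2 = k := by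
  have := h.step_a k; have := h.step_c k
  have := botRow_spec a c k; have := botRow_spec a c (k + 1); push_cast at *; omega

lemma topRow_botRow_step (h : IsTarget a c) (k : ℕ) :
    topRow a c (k + 1) = topRow a c k ∨ botRow a c (k + 1) = botRow a c k := by
  rcases topRow_step h k with h₁ | h₁
  · exact .inl h₁
  rcases botRow_step h k with h₂ | h₂
  · exact .inr h₂
  have := h.both k
  have := topRow_spec a c k; have := botRow_spec a c k
  have := topRow_spec a c (k + 1); have := botRow_spec a c (k + 1)
  have := le_topRow_topRow_botRow a c k
  have := topRow_botRow_botRow_le a c k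
  rcases topRow_increase h k h₁ with h₃ | h₃ | h₃ <;>
  rcases botRow_increase h k h₂ with h₄ | h₄ | h₄ <;> omega

lemma topRow_kink (h : IsTarget a c) (k : ℕ) (h₁ : topRow a c (k + 1) = topRow a c k)
    (h₂ : topRow a c (k + 2) = topRow a c (k + 1) + 1) :
    2 * topRow a c (k + 1) + botRow a c (k + 1) = k + 1 ∧
    (botRow a c (k + 1) = botRow a c k + 1 → topRow a c (k + 1) = botRow a c (k + 1)) := by
  have := topRow_increase h (k + 1) h₂
  have := botRow_increase h k
  have := h.step_a k; have := h.step_c k; have := h.both k; have := h.kink_a k; have := h.kink_c k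
  have := topRow_spec a c k; have := botRow_spec a c k
  have := topRow_spec a c (k + 1); have := botRow_spec a c (k + 1)
  have := le_topRow_topRow_botRow a c (k + 1)
  have := topRow_botRow_botRow_le a c (k + 1)
  rw [show k + 1 + 1 = k + 2 from rfl] at *
  push_cast at *
  omega

lemma botRow_kink (h : IsTarget a c) (k : ℕ) (h₁ : botRow a c (k + 1) = botRow a c k + 1)
    (h₂ : botRow a c (k + 2) = botRow a c (k + 1)) :
    topRow a c (k + 2) = topRow a c (k + 1) + 1 ∨
    topRow a c (k + 1) + 2 * botRow a c (k + 1) = k + 1 := by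
  have := topRow_step h (k + 1)
  have := botRow_increase h k h₁
  have := h.step_a k; have := h.step_c k; have := h.both k; have := h.kink_a k; have := h.kink_c k
  have := h.step_a (k + 1); have := h.step_c (k + 1)
  have := topRow_spec a c k; have := botRow_spec a c k
  have := topRow_spec a c (k + 1); have := botRow_spec a c (k + 1)
  have := topRow_spec a c (k + 2); have := botRow_spec a c (k + 2)
  have := le_topRow_topRow_botRow a c (k + 1)
  have := topRow_botRow_botRow_le a c (k + 1)
  rw [show k + 1 + 1 = k + 2 from rfl] at *
  push_cast at *
  omega
end

/-- The slopes of the path of growing partitions `l` on `[k, k + 1]`. -/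
def pathSlope (l : ℕ → Fin 3 → ℤ) (k : ℕ) (j : Fin 3) : ℝ := 1 - 3 * ((l (k + 1) j - l k j : ℤ) : ℝ)

/-- The piecewise linear interpolation of `k ↦ k - 3 * l k j`. -/
noncomputable def pathInterp (l : ℕ → Fin 3 → ℤ) (j : Fin 3) (q : ℝ) : ℝ :=
  (⌊q⌋₊ - 3 * l ⌊q⌋₊ j : ℝ) + pathSlope l ⌊q⌋₊ j * (q - ⌊q⌋₊)

lemma pathInterp_natCast (l : ℕ → Fin 3 → ℤ) (j : Fin 3) (k : ℕ) :
    pathInterp l j k = k - 3 * l k j := by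
  simp [pathInterp]

lemma pathInterp_of_mem_Icc (l : ℕ → Fin 3 → ℤ) (j : Fin 3) (k : ℕ) {q : ℝ}
    (hq : q ∈ Set.Icc (k : ℝ) (k + 1 : ℕ)) :
    pathInterp l j q = (k - 3 * l k j) + pathSlope l k j * (q - k) := by
  rcases hq.2.lt_or_eq with h | h
  · have : ⌊q⌋₊ = k := by
      rw [Nat.floor_eq_iff (le_trans (by positivity) hq.1)]
      exact ⟨hq.1, by exact_mod_cast h⟩
    simp [pathInterp, this]
  · subst h
    rw [pathInterp_natCast, pathSlope]
    push_cast
    ring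

/-- A path of growing three-row partitions, adding one box at a time, with a box added to a higher
row than the previous one only if the two rows have the same length, defines a `3`-system. -/
lemma isNSystem_pathInterp {l : ℕ → Fin 3 → ℤ} (h_zero : ∀ j, l 0 j = 0)
    (h_step : ∀ k j, l (k + 1) j = l k j ∨ l (k + 1) j = l k j + 1)
    (h_sum : ∀ k, ∑ j, l k j = k) (h_anti : ∀ k, Antitone (l k))
    (h_switch : ∀ k i j, l (k + 1) i = l k i + 1 → l (k + 2) i = l (k + 1) i →
      l (k + 1) j = l k j → l (k + 2) j = l (k + 1) j + 1 → i < j ∨ l (k + 1) i = l (k + 1) j) :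
    IsNSystem 3 (pathInterp l) := by
  have slope_eq : ∀ k j, (l (k + 1) j = l k j ∧ pathSlope l k j = 1) ∨
      (l (k + 1) j = l k j + 1 ∧ pathSlope l k j = -2) := by
    intro k j
    rcases h_step k j with h | h
    · left; simp [pathSlope, h]
    · right; simp [pathSlope, h]; norm_num
  have floor_mem : ∀ q : ℝ, 0 ≤ q → q ∈ Set.Icc (⌊q⌋₊ : ℝ) (⌊q⌋₊ + 1 : ℕ) := fun q hq =>
    ⟨Nat.floor_le hq, by exact_mod_cast (Nat.lt_floor_add_one q).le⟩
  refine ⟨fun k => k, pathSlope l, by simp, Nat.strictMono_cast, tendsto_natCast_atTop_atTop,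
    ?_, ?_, ?_, ?_, ?_, ?_⟩
  · intro j
    simpa [h_zero] using pathInterp_natCast l j 0
  · intro k j
    rcases slope_eq k j with h | h
    · exact .inr h.2
    · left; rw [h.2]; norm_num
  · intro k j q hq
    rw [pathInterp_of_mem_Icc l j k hq, pathInterp_natCast]
  · intro q hq i j hij
    rw [pathInterp_of_mem_Icc l i _ (floor_mem q hq), pathInterp_of_mem_Icc l j _ (floor_mem q hq)]
    have h₁ : (l ⌊q⌋₊ j : ℝ) ≤ l ⌊q⌋₊ i := by exact_mod_cast h_anti _ hij
    have h₂ : (l (⌊q⌋₊ + 1) j : ℝ) ≤ l (⌊q⌋₊ + 1) i := by exact_mod_cast h_anti _ hij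
    obtain ⟨h₃, h₄⟩ := floor_mem q hq
    push_cast at h₄
    simp only [pathSlope]
    push_cast
    nlinarith [mul_nonneg (sub_nonneg.2 h₁) (sub_nonneg.2 h₄),
      mul_nonneg (sub_nonneg.2 h₂) (sub_nonneg.2 h₃)]
  · intro q hq
    simp only [pathInterp_of_mem_Icc l _ _ (floor_mem q hq)]
    have h₁ : ∑ j, (l ⌊q⌋₊ j : ℝ) = ⌊q⌋₊ := by exact_mod_cast h_sum _
    have h₂ : ∑ j, (l (⌊q⌋₊ + 1) j : ℝ) = (⌊q⌋₊ + 1 : ℕ) := by exact_mod_cast h_sum _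
    simp only [Fin.sum_univ_three, pathSlope] at *
    push_cast at *
    linear_combination (3 * (q - ⌊q⌋₊) - 3) * h₁ - 3 * (q - ⌊q⌋₊) * h₂
  · intro k i j h₁ h₂ h₃ h₄
    rw [pathInterp_natCast, pathInterp_natCast]
    have key := h_switch k i j
    rcases slope_eq k i with ⟨_, h⟩ | ⟨e₁, -⟩
    · norm_num [h] at h₁
    rcases slope_eq (k + 1) i with ⟨e₂, -⟩ | ⟨_, h⟩
    swap
    · norm_num [h] at h₂
    rcases slope_eq k j with ⟨e₃, -⟩ | ⟨_, h⟩
    swap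
    · norm_num [h] at h₃
    rcases slope_eq (k + 1) j with ⟨_, h⟩ | ⟨e₄, -⟩
    · norm_num [h] at h₄
    exact (key e₁ e₂ e₃ e₄).imp_right fun h => by rw [h]

lemma partRows_step {a c : ℕ → ℤ} (h : IsTarget a c) (k : ℕ) (j : Fin 3) :
    partRows a c (k + 1) j = partRows a c k j ∨
      partRows a c (k + 1) j = partRows a c k j + 1 := by
  have := topRow_step h k
  have := botRow_step h k
  have := topRow_botRow_step h k
  fin_cases j <;> simp [partRows] <;> omega

lemma isNSystem_partRows {a c : ℕ → ℤ} (h : IsTarget a c) :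
    IsNSystem 3 (pathInterp (partRows a c)) := by
  apply isNSystem_pathInterp
  · have := h.zero_a
    have := h.zero_c
    have := topRow_spec a c 0
    have := botRow_spec a c 0
    have := le_topRow_topRow_botRow a c 0
    have := topRow_botRow_botRow_le a c 0
    intro j
    fin_cases j <;> simp [partRows] <;> push_cast at * <;> omega
  · exact partRows_step h
  · intro k
    simp [partRows, Fin.sum_univ_three]
    ring
  · intro k
    have := le_topRow_topRow_botRow a c k
    have := topRow_botRow_botRow_le a c k
    intro i j hij
    fin_cases i <;> fin_cases j <;> simp [partRows] at hij ⊢ <;> omega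
  · intro k i j
    have := topRow_kink h k
    have := botRow_kink h k
    have := topRow_step h k
    have := botRow_step h k
    have := topRow_botRow_step h k
    have := topRow_step h (k + 1)
    have := botRow_step h (k + 1)
    have := topRow_botRow_step h (k + 1)
    rw [show k + 1 + 1 = k + 2 from rfl] at *
    fin_cases i <;> fin_cases j <;> simp [partRows] <;> omega

/-- `g k` is the minimum over `i` of `max (α i - k) (β i)`. -/
structure IsEnvelope {ι : Type*} (α β : ι → ℤ) (g : ℕ → ℤ) : Prop where
  le : ∀ (k : ℕ) i, g k ≤ max (α i - k) (β i)
  exists_eq : ∀ k : ℕ, ∃ i, max (α i - k) (β i) = g k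

lemma Int.exists_forall_le_of_bddBelow {ι : Type*} {p : ι → Prop} (hp : ∃ i, p i) (f : ι → ℤ)
    (b : ℤ) (hb : ∀ i, p i → b ≤ f i) : ∃ i, p i ∧ ∀ j, p j → f i ≤ f j := by
  obtain ⟨i₀, hi₀⟩ := hp
  obtain ⟨z, ⟨i, hi, rfl⟩, hz⟩ := Int.exists_least_of_bdd (P := fun z => ∃ i, p i ∧ f i = z)
    ⟨b, by rintro z ⟨i, hi, rfl⟩; exact hb i hi⟩ ⟨f i₀, i₀, hi₀, rfl⟩
  exact ⟨i, hi, fun j hj => hz _ ⟨j, hj, rfl⟩⟩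

lemma exists_isEnvelope {ι : Type*} [Nonempty ι] {α : ι → ℤ} (β : ι → ℤ) (hα : ∀ i, 0 ≤ α i) :
    ∃ g, IsEnvelope α β g := by
  have key : ∀ k : ℕ, ∃ i, True ∧ ∀ j, True → max (α i - k) (β i) ≤ max (α j - k) (β j) := fun k =>
    Int.exists_forall_le_of_bddBelow ⟨Classical.arbitrary ι, trivial⟩ _ (-k) fun i _ =>
      le_max_of_le_left (by linarith [hα i])
  choose i _ hi using key
  exact ⟨fun k : ℕ => max (α (i k) - k) (β (i k)), fun k j => hi k j trivial, fun k => ⟨i k, rfl⟩⟩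

namespace IsEnvelope
variable {ι : Type*} {α β : ι → ℤ} {g : ℕ → ℤ}

lemma step (h : IsEnvelope α β g) (k : ℕ) : g (k + 1) = g k ∨ g (k + 1) = g k - 1 := by
  obtain ⟨i, hi⟩ := h.exists_eq k
  obtain ⟨j, hj⟩ := h.exists_eq (k + 1)
  have := h.le (k + 1) i
  have := h.le k j
  push_cast at *
  omega

lemma neg_le (h : IsEnvelope α β g) (hα : ∀ i, 0 ≤ α i) (k : ℕ) : -(k : ℤ) ≤ g k := by
  obtain ⟨i, hi⟩ := h.exists_eq k
  have := hα i
  omega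

lemma exists_of_kink (h : IsEnvelope α β g) (k : ℕ) (h₁ : g (k + 1) = g k)
    (h₂ : g (k + 2) = g (k + 1) - 1) :
    ∃ i j, α j < α i ∧ β i < β j ∧ max (α i - (k + 1 : ℕ)) (β i) ≤ g (k + 1) ∧
      max (α j - (k + 1 : ℕ)) (β j) ≤ g (k + 1) := by
  obtain ⟨i, hi⟩ := h.exists_eq (k + 2)
  obtain ⟨j, hj⟩ := h.exists_eq k
  have := h.le (k + 1) i
  have := h.le (k + 1) j
  have := h.le (k + 2) j
  refine ⟨i, j, ?_⟩
  push_cast at *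
  omega

lemma exists_of_decrease (h : IsEnvelope α β g) (k : ℕ) (h₁ : g (k + 1) = g k - 1) :
    ∃ i, α i = g k + k ∧ β i ≤ g k - 1 := by
  obtain ⟨i, hi⟩ := h.exists_eq (k + 1)
  have := h.le k i
  refine ⟨i, ?_⟩
  push_cast at *
  omega

lemma exists_of_constant (h : IsEnvelope α β g) (k : ℕ) (h₁ : g (k + 1) = g k) :
    ∃ i, β i = g k ∧ α i ≤ g k + k := by
  obtain ⟨i, hi⟩ := h.exists_eq k
  have := h.le (k + 1) i
  refine ⟨i, ?_⟩
  push_cast at *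
  omega
end IsEnvelope

/-- The smallest integer `z` such that `x ≤ exp (3 * z)`. -/
noncomputable def ceilLog (x : ℝ) : ℤ := ⌈Real.log x / 3⌉

lemma le_exp_ceilLog {x : ℝ} (hx : 0 < x) : x ≤ Real.exp (3 * ceilLog x) := by
  have := Int.le_ceil (Real.log x / 3)
  rw [← Real.log_le_iff_le_exp hx, ceilLog]
  linarith

lemma exp_ceilLog_lt {x : ℝ} (hx : 0 < x) : Real.exp (3 * ceilLog x - 3) < x := by
  have := Int.ceil_lt_add_one (Real.log x / 3)
  rw [← Real.lt_log_iff_exp_lt hx, ceilLog]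
  linarith

lemma ceilLog_mono {x y : ℝ} (hx : 0 < x) (hxy : x ≤ y) : ceilLog x ≤ ceilLog y :=
  Int.ceil_mono (by have := Real.log_le_log hx hxy; linarith)

lemma lt_of_ceilLog_lt {x y : ℝ} (hy : 0 < y) (h : ceilLog x < ceilLog y) : x < y := by
  by_contra! h'
  exact (ceilLog_mono hy h').not_gt h

lemma ceilLog_nonneg {x : ℝ} (hx : 1 ≤ x) : 0 ≤ ceilLog x :=
  Int.ceil_nonneg (by have := Real.log_nonneg hx; positivity)

/-- A pair consisting of the size `X`, either zero or at least one, and the distance `Y > 0`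
attached to a nonzero lattice point. -/
structure IsSizePair (X Y : ℝ) : Prop where
  pos : 0 < Y
  cases : (X = 0 ∧ 1 ≤ Y) ∨ 1 ≤ X

namespace IsSizePair
variable {X Y : ℝ}

lemma nonneg (h : IsSizePair X Y) : 0 ≤ X := by
  rcases h.cases with h | h <;> linarith

lemma max_le_exp (h : IsSizePair X Y) (k : ℕ) :
    max (X * Real.exp (-3 * k)) Y ≤ Real.exp (3 * (max (ceilLog (max 1 X) - k) (ceilLog Y) : ℤ)) := by
  apply max_le
  · have h₁ : X ≤ _ := (le_max_right 1 X).trans (le_exp_ceilLog (lt_max_of_lt_left one_pos))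
    calc _ ≤ Real.exp (3 * ceilLog (max 1 X)) * Real.exp (-3 * k) := by gcongr
      _ = Real.exp (3 * (ceilLog (max 1 X) - k : ℤ)) := by rw [← Real.exp_add]; push_cast; ring_nf
      _ ≤ _ := by gcongr; exact le_max_left _ _
  · refine (le_exp_ceilLog h.pos).trans ?_
    gcongr
    exact le_max_right _ _

lemma exp_lt_max (h : IsSizePair X Y) (k : ℕ) :
    Real.exp (3 * (max (ceilLog (max 1 X) - k) (ceilLog Y) : ℤ) - 3) <
      max (X * Real.exp (-3 * k)) Y := by
  have hY := exp_ceilLog_lt h.pos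
  rcases le_total (ceilLog (max 1 X) - k) (ceilLog Y) with h₁ | h₁
  · rw [max_eq_right h₁]
    exact lt_max_of_lt_right hY
  rw [max_eq_left h₁]
  rcases h.cases with ⟨rfl, h₂⟩ | h₂
  · have h₃ := ceilLog_nonneg h₂
    have h₄ : ceilLog (max 1 0) = 0 := by simp [ceilLog]
    have h₅ : ceilLog (max 1 0) - k = ceilLog Y := by omega
    rw [h₅]
    exact lt_max_of_lt_right hY
  · apply lt_max_of_lt_left
    have := exp_ceilLog_lt (x := X) (by linarith)
    rw [max_eq_right h₂]
    calc _ = Real.exp (3 * ceilLog X - 3) * Real.exp (-3 * k) := by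
          rw [← Real.exp_add]; push_cast; ring_nf
      _ < _ := by gcongr
end IsSizePair

open Matrix MeasureTheory in
/-- Minkowski's linear forms theorem in dimension three. -/
lemma exists_ne_zero_abs_mulVec_lt (M : Matrix (Fin 3) (Fin 3) ℝ) (hM : M.det ≠ 0) (c : Fin 3 → ℝ)
    (hc : ∀ i, 0 < c i) (h : |M.det| < c 0 * c 1 * c 2) :
    ∃ n : Fin 3 → ℤ, n ≠ 0 ∧ ∀ i, |(M *ᵥ fun j => (n j : ℝ)) i| < c i := by
  set b := Pi.basisFun ℝ (Fin 3)
  set s : Set (Fin 3 → ℝ) := Matrix.toLin' M ⁻¹' Set.univ.pi fun i => Set.Ioo (-c i) (c i)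
  have hdet : LinearMap.det (Matrix.toLin' M) = M.det := LinearMap.det_toLin' M
  have hs : volume s = ENNReal.ofReal (|M.det|⁻¹ * (8 * (c 0 * c 1 * c 2))) := by
    rw [Measure.addHaar_preimage_linearMap _ (by rwa [hdet]), Real.volume_pi_Ioo, hdet,
      ← ENNReal.ofReal_prod_of_nonneg (fun i _ => by linarith [hc i]),
      ← ENNReal.ofReal_mul (abs_nonneg _), Fin.prod_univ_three, abs_inv]
    ring_nf
  have hpos : 0 < |M.det| := abs_pos.mpr hM
  have : Countable (Submodule.span ℤ (Set.range b)).toAddSubgroup :=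
    inferInstanceAs (Countable (Submodule.span ℤ (Set.range b)))
  obtain ⟨⟨x, hx⟩, hx0, hxs⟩ := exists_ne_zero_mem_lattice_of_measure_mul_two_pow_lt_measure
    (μ := volume) (L := (Submodule.span ℤ (Set.range b)).toAddSubgroup)
    (F := ZSpan.fundamentalDomain b) (s := s) (ZSpan.isAddFundamentalDomain' b volume)
    (fun x hx i _ => by
      have := hx i trivial
      simp only [map_neg, Pi.neg_apply, Set.mem_Ioo] at this ⊢
      constructor <;> linarith)
    ((convex_pi fun i _ => convex_Ioo _ _).linear_preimage _)
    (by
      rw [hs, ZSpan.fundamentalDomain_pi_basisFun, Real.volume_pi_Ico]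
      simp only [sub_zero, ENNReal.ofReal_one, Finset.prod_const_one, Module.finrank_fin_fun, one_mul]
      rw [show (2 : ENNReal) ^ 3 = ENNReal.ofReal 8 by norm_num, ENNReal.ofReal_lt_ofReal_iff]
      · rw [inv_mul_eq_div, lt_div_iff₀ hpos]
        linarith
      · have := mul_pos (mul_pos (hc 0) (hc 1)) (hc 2)
        positivity)
  have hx' := (b.mem_span_iff_repr_mem ℤ x).mp hx
  choose n hn using hx'
  have hxn : x = fun j => (n j : ℝ) := by
    ext j
    simpa [b] using (hn j).symm
  refine ⟨n, ?_, fun i => ?_⟩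
  · rintro rfl
    apply hx0
    ext j
    simp [hxn]
  · have := hxs i trivial
    simp only [hxn, Matrix.toLin'_apply] at this
    exact abs_lt.mpr this

section
open Matrix

/-- The vectors `n i` and the logarithmic bounds `r i` realise, up to a factor `e`, the successive
minima of the function `N` on `ℤ³`. -/
structure IsMinimalTriple (N : (Fin 3 → ℤ) → ℝ) (n : Fin 3 → Fin 3 → ℤ) (r : Fin 3 → ℤ) :
    Prop where
  le_exp : ∀ i, N (n i) ≤ Real.exp (r i)
  ne_zero : n 0 ≠ 0
  cross_ne_zero : n 0 ⨯₃ n 1 ≠ 0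
  triple_ne_zero : (n 0 ⨯₃ n 1) ⬝ᵥ n 2 ≠ 0
  lt_of_ne_zero : ∀ m, m ≠ 0 → Real.exp (r 0 - 1) < N m
  lt_of_cross_ne_zero : ∀ m, n 0 ⨯₃ m ≠ 0 → Real.exp (r 1 - 1) < N m
  lt_of_triple_ne_zero : ∀ m, (n 0 ⨯₃ n 1) ⬝ᵥ m ≠ 0 → Real.exp (r 2 - 1) < N m

lemma exists_le_exp_of_pos_le {ι : Type*} {p : ι → Prop} (hp : ∃ i, p i) {N : ι → ℝ} {δ : ℝ}
    (hδ : 0 < δ) (h : ∀ i, p i → δ ≤ N i) :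
    ∃ i, ∃ r : ℤ, p i ∧ N i ≤ Real.exp r ∧ ∀ j, p j → Real.exp (r - 1) < N j := by
  obtain ⟨i, hi, hmin⟩ := Int.exists_forall_le_of_bddBelow hp (fun i => ⌈Real.log (N i)⌉)
    ⌈Real.log δ⌉ fun i hi => Int.ceil_mono (Real.log_le_log hδ (h i hi))
  refine ⟨i, ⌈Real.log (N i)⌉, hi, ?_, fun j hj => ?_⟩
  · rw [← Real.log_le_iff_le_exp (hδ.trans_le (h i hi))]
    exact Int.le_ceil _
  · rw [← Real.lt_log_iff_exp_lt (hδ.trans_le (h j hj))]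
    have h₁ : (⌈Real.log (N i)⌉ : ℝ) ≤ ⌈Real.log (N j)⌉ := by exact_mod_cast hmin j hj
    have h₂ := Int.ceil_lt_add_one (Real.log (N j))
    linarith

lemma exists_cross_ne_zero {n : Fin 3 → ℤ} (hn : n ≠ 0) : ∃ m, n ⨯₃ m ≠ 0 := by
  by_contra! h
  have h₀ := h ![1, 0, 0]
  have h₁ := h ![0, 1, 0]
  simp [cross_apply] at h₀ h₁
  apply hn
  ext i
  fin_cases i <;> simp [h₀, h₁]

lemma exists_isMinimalTriple {N : (Fin 3 → ℤ) → ℝ} {δ : ℝ} (hδ : 0 < δ)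
    (h : ∀ n, n ≠ 0 → δ ≤ N n) : ∃ n r, IsMinimalTriple N n r := by
  obtain ⟨n₀, r₀, h₀, h₀', h₀''⟩ := exists_le_exp_of_pos_le (exists_ne (0 : Fin 3 → ℤ)) hδ h
  obtain ⟨n₁, r₁, h₁, h₁', h₁''⟩ := exists_le_exp_of_pos_le (exists_cross_ne_zero h₀) hδ
    fun m hm => h m (by rintro rfl; simp at hm)
  obtain ⟨n₂, r₂, h₂, h₂', h₂''⟩ := exists_le_exp_of_pos_le
    (p := fun m => (n₀ ⨯₃ n₁) ⬝ᵥ m ≠ 0) ⟨_, fun h => h₁ (dotProduct_self_eq_zero.mp h)⟩ hδ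
    fun m hm => h m (by rintro rfl; simp at hm)
  refine ⟨![n₀, n₁, n₂], ![r₀, r₁, r₂], ?_, h₀, h₁, h₂, h₀'', h₁'', h₂''⟩
  intro i
  fin_cases i <;> simpa

namespace IsMinimalTriple
variable {N : (Fin 3 → ℤ) → ℝ} {n : Fin 3 → Fin 3 → ℤ} {r : Fin 3 → ℤ}

lemma le_of_lt_exp {a b : ℤ} {x : ℝ} (h₁ : Real.exp (a - 1) < x) (h₂ : x ≤ Real.exp b) : a ≤ b := by
  have h := Real.exp_lt_exp.mp (h₁.trans_le h₂)
  have : a - 1 < b := by exact_mod_cast h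
  omega

lemma zero_le_one (h : IsMinimalTriple N n r) : r 0 ≤ r 1 :=
  le_of_lt_exp (h.lt_of_ne_zero _ (by intro h'; apply h.cross_ne_zero; simp [h'])) (h.le_exp 1)

lemma one_le_two (h : IsMinimalTriple N n r) : r 1 ≤ r 2 := by
  refine le_of_lt_exp (h.lt_of_cross_ne_zero _ fun h' => h.triple_ne_zero ?_) (h.le_exp 2)
  have : (n 0 ⨯₃ n 1) ⬝ᵥ n 2 = -((n 0 ⨯₃ n 2) ⬝ᵥ n 1) := by
    simp only [vec3_dotProduct, cross_apply, cons_val]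
    ring
  simp [this, h']

/-- A covector orthogonal to all the members of a minimal triple vanishes. -/
lemma exists_dotProduct_ne_zero (h : IsMinimalTriple N n r) {m : Fin 3 → ℤ} (hm : m ≠ 0) :
    ∃ i, n i ⬝ᵥ m ≠ 0 := by
  by_contra! h'
  apply hm
  have key : ((n 0 ⨯₃ n 1) ⬝ᵥ n 2) • m =
      (n 0 ⬝ᵥ m) • (n 1 ⨯₃ n 2) + (n 1 ⬝ᵥ m) • (n 2 ⨯₃ n 0) + (n 2 ⬝ᵥ m) • (n 0 ⨯₃ n 1) := by
    ext i
    simp only [vec3_dotProduct, cross_apply, Pi.add_apply, Pi.smul_apply, smul_eq_mul]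
    fin_cases i <;> simp only [Fin.zero_eta, Fin.mk_one, Fin.reduceFinMk, cons_val] <;> ring
  simpa only [h', zero_smul, add_zero, smul_eq_zero, h.triple_ne_zero, false_or] using key

end IsMinimalTriple

lemma dotProduct_self_mul_frame {u z η : Fin 3 → ℝ} (h : u ⬝ᵥ η = 0) :
    (z ⬝ᵥ z) * ((u ⬝ᵥ u) * (η ⬝ᵥ η)) = (u ⬝ᵥ z) ^ 2 * (η ⬝ᵥ η) + (η ⬝ᵥ z) ^ 2 * (u ⬝ᵥ u) +
      ((η ⨯₃ u) ⬝ᵥ z) ^ 2 := by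
  simp only [vec3_dotProduct, cross_apply, cons_val] at *
  linear_combination ((z 0 * z 0 + z 1 * z 1 + z 2 * z 2) * (u 0 * η 0 + u 1 * η 1 + u 2 * η 2) -
    2 * (u 0 * z 0 + u 1 * z 1 + u 2 * z 2) * (η 0 * z 0 + η 1 * z 1 + η 2 * z 2)) * h

lemma det_frame (u η : Fin 3 → ℝ) (h : u ⬝ᵥ η = 0) :
    (Matrix.of ![u, η ⨯₃ u, η]).det = (u ⬝ᵥ u) * (η ⬝ᵥ η) := by
  simp only [vec3_dotProduct, cross_apply, cons_val, det_fin_three, Matrix.of_apply] at *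
  linear_combination -(u 0 * η 0 + u 1 * η 1 + u 2 * η 2) * h

end

section
open Matrix

lemma sq_lt_dotProduct_self {z : Fin 3 → ℝ} {x : ℝ} (hx : 0 ≤ x) (h : x < ‖z‖) :
    x ^ 2 < z ⬝ᵥ z := by
  by_contra! h'
  refine h.not_ge ((pi_norm_le_iff_of_nonneg hx).mpr fun i => abs_le_of_sq_le_sq ?_ hx)
  rw [vec3_dotProduct] at h'
  fin_cases i <;> simp only [Fin.zero_eta, Fin.mk_one, Fin.reduceFinMk] <;>
    linarith [mul_self_nonneg (z 0), mul_self_nonneg (z 1), mul_self_nonneg (z 2)]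

lemma abs_dotProduct_le (u v : Fin 3 → ℝ) : |u ⬝ᵥ v| ≤ 3 * (‖u‖ * ‖v‖) := by
  have h : ∀ i, |u i * v i| ≤ ‖u‖ * ‖v‖ := fun i => by
    rw [abs_mul]
    exact mul_le_mul (norm_le_pi_norm u i) (norm_le_pi_norm v i) (abs_nonneg _) (norm_nonneg _)
  rw [vec3_dotProduct]
  linarith [abs_add_three (u 0 * v 0) (u 1 * v 1) (u 2 * v 2), h 0, h 1, h 2]

lemma norm_cross_le (u v : Fin 3 → ℝ) : ‖u ⨯₃ v‖ ≤ 2 * (‖u‖ * ‖v‖) := by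
  have h : ∀ i j, |u i * v j| ≤ ‖u‖ * ‖v‖ := fun i j => by
    rw [abs_mul]
    exact mul_le_mul (norm_le_pi_norm u i) (norm_le_pi_norm v j) (abs_nonneg _) (norm_nonneg _)
  have h' : ∀ i j k l, |u i * v j - u k * v l| ≤ 2 * (‖u‖ * ‖v‖) := fun i j k l => by
    linarith [abs_sub (u i * v j) (u k * v l), h i j, h k l]
  rw [pi_norm_le_iff_of_nonneg (by positivity), cross_apply]
  intro i
  fin_cases i <;> exact h' _ _ _ _

/-- The lattice point attached to `n`, rescaled so that the box becomes a cube. -/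
noncomputable def latticeVec (ξ₁ ξ₂ e : ℝ) (n : Fin 3 → ℤ) : Fin 3 → ℝ :=
  ![n 0 / e ^ 2, (ξ₁ * n 0 - n 1) * e, (ξ₂ * n 0 - n 2) * e]

/-- The point of the dual lattice attached to `m`, rescaled. -/
noncomputable def dualVec (ξ₁ ξ₂ e : ℝ) (m : Fin 3 → ℤ) : Fin 3 → ℝ :=
  ![(m 0 + m 1 * ξ₁ + m 2 * ξ₂) * e ^ 2, -m 1 / e, -m 2 / e]

variable {ξ₁ ξ₂ e : ℝ}

lemma latticeVec_dotProduct_dualVec (he : e ≠ 0) (n m : Fin 3 → ℤ) :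
    latticeVec ξ₁ ξ₂ e n ⬝ᵥ dualVec ξ₁ ξ₂ e m = (n ⬝ᵥ m : ℤ) := by
  simp only [vec3_dotProduct, latticeVec, dualVec, cons_val]
  push_cast
  field_simp
  ring

lemma latticeVec_cross (he : e ≠ 0) (n n' : Fin 3 → ℤ) :
    latticeVec ξ₁ ξ₂ e n ⨯₃ latticeVec ξ₁ ξ₂ e n' = dualVec ξ₁ ξ₂ e (n ⨯₃ n') := by
  ext i
  simp only [cross_apply, latticeVec, dualVec]
  fin_cases i <;> simp only [Fin.zero_eta, Fin.mk_one, Fin.reduceFinMk, cons_val] <;> push_cast <;>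
    field_simp <;> ring

lemma dualVec_cross (he : e ≠ 0) (n n' : Fin 3 → ℤ) :
    dualVec ξ₁ ξ₂ e n ⨯₃ dualVec ξ₁ ξ₂ e n' = latticeVec ξ₁ ξ₂ e (n ⨯₃ n') := by
  ext i
  simp only [cross_apply, latticeVec, dualVec]
  fin_cases i <;> simp only [Fin.zero_eta, Fin.mk_one, Fin.reduceFinMk, cons_val] <;> push_cast <;>
    field_simp <;> ring

lemma exists_latticeVec_eq_mulVec (he : e ≠ 0) :
    ∃ A : Matrix (Fin 3) (Fin 3) ℝ, A.det = 1 ∧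
      ∀ n : Fin 3 → ℤ, latticeVec ξ₁ ξ₂ e n = A *ᵥ fun j => (n j : ℝ) := by
  refine ⟨!![1 / e ^ 2, 0, 0; ξ₁ * e, -e, 0; ξ₂ * e, 0, -e], ?_, fun n => ?_⟩
  · simp [det_fin_three]
    field_simp
  · ext i
    simp only [mulVec, vec3_dotProduct, latticeVec, of_apply]
    fin_cases i <;> simp only [Fin.zero_eta, Fin.mk_one, Fin.reduceFinMk, cons_val] <;> ring

/-- Minkowski's second theorem for the rescaled lattice. -/
lemma IsMinimalTriple.sum_le (he : e ≠ 0) {n : Fin 3 → Fin 3 → ℤ} {r : Fin 3 → ℤ}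
    (h : IsMinimalTriple (fun n => ‖latticeVec ξ₁ ξ₂ e n‖) n r) : r 0 + r 1 + r 2 ≤ 5 := by
  by_contra! hr
  obtain ⟨A, hA, hA'⟩ := exists_latticeVec_eq_mulVec (ξ₁ := ξ₁) (ξ₂ := ξ₂) he
  set u := latticeVec ξ₁ ξ₂ e (n 0) with hu
  set η := dualVec ξ₁ ξ₂ e (n 0 ⨯₃ n 1) with hη
  have hη' : η = u ⨯₃ latticeVec ξ₁ ξ₂ e (n 1) := (latticeVec_cross he _ _).symm
  have huη : u ⬝ᵥ η = 0 := by rw [hη', dot_self_cross]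
  have hη0 : η ≠ 0 := by
    intro h0
    have := latticeVec_dotProduct_dualVec (ξ₁ := ξ₁) (ξ₂ := ξ₂) he (n 2) (n 0 ⨯₃ n 1)
    rw [← hη, h0, dotProduct_zero, dotProduct_comm] at this
    exact h.triple_ne_zero (by exact_mod_cast this.symm)
  have hu0 : u ≠ 0 := by
    intro h0
    rw [h0] at hη'
    exact hη0 (by simpa using hη')
  have hU : 0 < u ⬝ᵥ u := by simpa using dotProduct_star_self_pos_iff.mpr hu0
  have hH : 0 < η ⬝ᵥ η := by simpa using dotProduct_star_self_pos_iff.mpr hη0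
  set U := u ⬝ᵥ u
  set H := η ⬝ᵥ η
  set R : Fin 3 → ℝ := fun i => Real.exp (r i - 1) with hR
  have hRpos : ∀ i, 0 < R i := fun i => Real.exp_pos _
  have hR01 : R 0 ≤ R 1 := Real.exp_le_exp.mpr (by have := h.zero_le_one; gcongr)
  have hR12 : R 1 ≤ R 2 := Real.exp_le_exp.mpr (by have := h.one_le_two; gcongr)
  have hR8 : 8 < R 0 * R 1 * R 2 := by
    rw [hR, ← Real.exp_add, ← Real.exp_add]
    have h3 : (3 : ℝ) ≤ (r 0 - 1) + (r 1 - 1) + (r 2 - 1) := by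
      have : (6 : ℝ) ≤ r 0 + r 1 + r 2 := by exact_mod_cast hr
      linarith
    refine lt_of_lt_of_le ?_ (Real.exp_le_exp.mpr h3)
    have := Real.exp_one_gt_d9
    have h' : Real.exp 3 = Real.exp 1 ^ 3 := by rw [← Real.exp_nat_mul]; norm_num
    rw [h']
    calc (8 : ℝ) = 2 ^ 3 := by norm_num
      _ < _ := by gcongr; linarith
  have hM : (Matrix.of ![u, η ⨯₃ u, η] * A).det = U * H := by
    rw [det_mul, hA, mul_one, det_frame u η huη]
  have hU' := Real.sq_sqrt hU.le
  have hH' := Real.sq_sqrt hH.le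
  have hsU := Real.sqrt_pos.mpr hU
  have hsH := Real.sqrt_pos.mpr hH
  set a := √U
  set b := √H
  obtain ⟨x, hx0, hx⟩ := exists_ne_zero_abs_mulVec_lt _ (by rw [hM]; positivity)
    ![a * R 0 / 2, a * b * R 1 / 2, b * R 2 / 2]
    (by
      have := hRpos 0
      have := hRpos 1
      have := hRpos 2
      intro i
      fin_cases i <;> simp <;> positivity)
    (by
      rw [hM, abs_of_pos (by positivity), ← hU', ← hH']
      simp only [cons_val]
      have := mul_lt_mul_of_pos_left hR8 (show 0 < a ^ 2 * b ^ 2 by positivity)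
      linarith)
  rw [← mulVec_mulVec, ← hA'] at hx
  set z := latticeVec ξ₁ ξ₂ e x with hz
  have h0 : |u ⬝ᵥ z| < a * R 0 / 2 := hx 0
  have h1 : |(η ⨯₃ u) ⬝ᵥ z| < a * b * R 1 / 2 := hx 1
  have h2 : |η ⬝ᵥ z| < b * R 2 / 2 := hx 2
  have h0' : (u ⬝ᵥ z) ^ 2 * H ≤ (R 0 / 2) ^ 2 * (U * H) := by
    have := sq_le_sq' (abs_lt.mp h0).1.le (abs_lt.mp h0).2.le
    calc _ ≤ (a * R 0 / 2) ^ 2 * H := by gcongr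
      _ = (R 0 / 2) ^ 2 * (a ^ 2 * H) := by ring
      _ = _ := by rw [hU']
  have h1' : ((η ⨯₃ u) ⬝ᵥ z) ^ 2 ≤ (R 1 / 2) ^ 2 * (U * H) := by
    have := sq_le_sq' (abs_lt.mp h1).1.le (abs_lt.mp h1).2.le
    calc _ ≤ (a * b * R 1 / 2) ^ 2 := this
      _ = (R 1 / 2) ^ 2 * (a ^ 2 * b ^ 2) := by ring
      _ = _ := by rw [hU', hH']
  have h2' : (η ⬝ᵥ z) ^ 2 * U ≤ (R 2 / 2) ^ 2 * (U * H) := by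
    have := sq_le_sq' (abs_lt.mp h2).1.le (abs_lt.mp h2).2.le
    calc _ ≤ (b * R 2 / 2) ^ 2 * U := by gcongr
      _ = (R 2 / 2) ^ 2 * (U * b ^ 2) := by ring
      _ = _ := by rw [hH']
  have frame := dotProduct_self_mul_frame (z := z) huη
  change z ⬝ᵥ z * (U * H) = _ * H + _ * U + _ at frame
  have hUH : 0 < U * H := by positivity
  have le_of {t : ℝ} (ht : z ⬝ᵥ z * (U * H) ≤ t * (U * H)) : z ⬝ᵥ z ≤ t :=
    le_of_mul_le_mul_right ht hUH
  have hsq01 : R 0 ^ 2 ≤ R 1 ^ 2 := by have := hRpos 0; gcongr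
  have hsq12 : R 1 ^ 2 ≤ R 2 ^ 2 := by have := hRpos 1; gcongr
  have hηz : η ⬝ᵥ z = 0 := by
    by_contra h'
    rw [dotProduct_comm, latticeVec_dotProduct_dualVec he] at h'
    have := sq_lt_dotProduct_self (hRpos 2).le (h.lt_of_triple_ne_zero x (by
      rw [dotProduct_comm]
      exact_mod_cast h'))
    have := le_of (t := (R 0 / 2) ^ 2 + (R 1 / 2) ^ 2 + (R 2 / 2) ^ 2) (by linarith)
    linarith [pow_pos (hRpos 2) 2]
  rw [hηz] at frame
  have hwz : (η ⨯₃ u) ⬝ᵥ z = 0 := by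
    by_contra h'
    have := sq_lt_dotProduct_self (hRpos 1).le (h.lt_of_cross_ne_zero x fun h0 => h' (by
      rw [dotProduct_comm, triple_product_permutation, latticeVec_cross he, h0]
      simp [dualVec]))
    have := le_of (t := (R 0 / 2) ^ 2 + (R 1 / 2) ^ 2) (by linarith)
    linarith [pow_pos (hRpos 1) 2]
  rw [hwz] at frame
  have := sq_lt_dotProduct_self (hRpos 0).le (h.lt_of_ne_zero x hx0)
  have := le_of (t := (R 0 / 2) ^ 2) (by linarith)
  linarith [pow_pos (hRpos 0) 2]

end

section
open Matrix

lemma norm_cons_three (a b c : ℝ) : ‖![a, b, c]‖ = max |a| (max |b| |c|) := by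
  apply le_antisymm
  · rw [pi_norm_le_iff_of_nonneg (by positivity)]
    intro i
    fin_cases i <;> simp
  · have h := norm_le_pi_norm ![a, b, c]
    exact max_le (h 0) (max_le (h 1) (h 2))

lemma int_add_mul_ne_zero {ξ₁ ξ₂ : ℝ} (hind : LinearIndependent ℚ ![(1 : ℝ), ξ₁, ξ₂])
    {m : Fin 3 → ℤ} (hm : m ≠ 0) : (m 0 + m 1 * ξ₁ + m 2 * ξ₂ : ℝ) ≠ 0 := by
  intro h
  apply hm
  have := Fintype.linearIndependent_iff.mp hind (fun i => (m i : ℚ)) (by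
    simpa [Fin.sum_univ_three, Rat.smul_def] using h)
  ext i
  exact_mod_cast this i

/-- The distance from the multiples of `(ξ₁, ξ₂)` to the integer points, attached to `n`. -/
noncomputable def pointDist (ξ₁ ξ₂ : ℝ) (n : Fin 3 → ℤ) : ℝ := max |ξ₁ * n 0 - n 1| |ξ₂ * n 0 - n 2|

/-- The absolute value of the linear form attached to `m`. -/
noncomputable def formDist (ξ₁ ξ₂ : ℝ) (m : Fin 3 → ℤ) : ℝ := |m 0 + m 1 * ξ₁ + m 2 * ξ₂|

/-- The height of the linear form attached to `m`. -/
noncomputable def formHeight (m : Fin 3 → ℤ) : ℝ := max |(m 1 : ℝ)| |(m 2 : ℝ)|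

variable {ξ₁ ξ₂ : ℝ}

lemma norm_latticeVec (n : Fin 3 → ℤ) (k : ℕ) : ‖latticeVec ξ₁ ξ₂ (Real.exp k) n‖ =
    Real.exp k * max (|(n 0 : ℝ)| * Real.exp (-3 * k)) (pointDist ξ₁ ξ₂ n) := by
  have h : Real.exp (-3 * k) = (Real.exp k ^ 3)⁻¹ := by
    rw [← Real.exp_nat_mul, ← Real.exp_neg]; push_cast; ring_nf
  rw [latticeVec, norm_cons_three, pointDist, mul_max_of_nonneg _ _ (Real.exp_pos _).le,
    mul_max_of_nonneg _ _ (Real.exp_pos _).le, h]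
  simp only [abs_mul, abs_div, abs_pow, Real.abs_exp]
  congr 1
  · field_simp
  · simp only [mul_comm]

lemma norm_dualVec (m : Fin 3 → ℤ) (k : ℕ) : ‖dualVec ξ₁ ξ₂ (Real.exp k) m‖ =
    Real.exp (2 * k) * max (formHeight m * Real.exp (-3 * k)) (formDist ξ₁ ξ₂ m) := by
  have h : Real.exp (-3 * k) = (Real.exp k ^ 3)⁻¹ := by
    rw [← Real.exp_nat_mul, ← Real.exp_neg]; push_cast; ring_nf
  have h' : Real.exp (2 * k) = Real.exp k ^ 2 := by
    rw [← Real.exp_nat_mul]; push_cast; ring_nf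
  rw [dualVec, norm_cons_three, formDist, formHeight, mul_max_of_nonneg _ _ (Real.exp_pos _).le,
    max_mul_of_nonneg _ _ (Real.exp_pos _).le, mul_max_of_nonneg _ _ (Real.exp_pos _).le, h, h',
    max_comm]
  simp only [abs_mul, abs_div, abs_pow, abs_neg, Real.abs_exp]
  congr 1
  · congr 1 <;> field_simp
  · simp only [mul_comm]

lemma one_le_abs_intCast {z : ℤ} (hz : z ≠ 0) : 1 ≤ |(z : ℝ)| := by
  exact_mod_cast Int.one_le_abs hz

lemma isSizePair_pointDist (hind : LinearIndependent ℚ ![(1 : ℝ), ξ₁, ξ₂]) {n : Fin 3 → ℤ}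
    (hn : n ≠ 0) : IsSizePair |(n 0 : ℝ)| (pointDist ξ₁ ξ₂ n) := by
  by_cases h0 : n 0 = 0
  · have h : 1 ≤ pointDist ξ₁ ξ₂ n := by
      simp only [pointDist, h0, Int.cast_zero, mul_zero, zero_sub, abs_neg, le_max_iff]
      by_cases h1 : n 1 = 0
      · refine .inr (one_le_abs_intCast fun h2 => hn ?_)
        ext i
        fin_cases i <;> assumption
      · exact .inl (one_le_abs_intCast h1)
    exact ⟨by linarith, .inl ⟨by simp [h0], h⟩⟩
  · refine ⟨lt_max_of_lt_left (abs_pos.mpr fun h => ?_), .inr (one_le_abs_intCast h0)⟩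
    refine int_add_mul_ne_zero hind (m := ![-n 1, n 0, 0]) (fun h' => h0 ?_) ?_
    · simpa using congrFun h' 1
    · simp
      linarith

lemma isSizePair_formDist (hind : LinearIndependent ℚ ![(1 : ℝ), ξ₁, ξ₂]) {m : Fin 3 → ℤ}
    (hm : m ≠ 0) : IsSizePair (formHeight m) (formDist ξ₁ ξ₂ m) := by
  refine ⟨abs_pos.mpr (int_add_mul_ne_zero hind hm), ?_⟩
  by_cases h1 : m 1 = 0
  · by_cases h2 : m 2 = 0
    · refine .inl ⟨by simp [formHeight, h1, h2], ?_⟩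
      simp only [formDist, h1, h2, Int.cast_zero, zero_mul, add_zero]
      refine one_le_abs_intCast fun h0 => hm ?_
      ext i
      fin_cases i <;> assumption
    · exact .inr (le_max_of_le_right (one_le_abs_intCast h2))
  · exact .inr (le_max_of_le_left (one_le_abs_intCast h1))

lemma cross_eq_zero_iff {n n' : Fin 3 → ℤ} : n ⨯₃ n' = 0 ↔
    n 1 * n' 2 = n 2 * n' 1 ∧ n 2 * n' 0 = n 0 * n' 2 ∧ n 0 * n' 1 = n 1 * n' 0 := by
  rw [cross_apply, funext_iff, Fin.forall_fin_succ, Fin.forall_fin_two]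
  simp [sub_eq_zero]

lemma abs_mul_pointDist {n n' : Fin 3 → ℤ} (h : n ⨯₃ n' = 0) :
    |(n 0 : ℝ)| * pointDist ξ₁ ξ₂ n' = |(n' 0 : ℝ)| * pointDist ξ₁ ξ₂ n := by
  obtain ⟨-, h₂, h₁⟩ := cross_eq_zero_iff.mp h
  rify at h₁ h₂
  rw [pointDist, pointDist, mul_max_of_nonneg _ _ (abs_nonneg (n 0 : ℝ)),
    mul_max_of_nonneg _ _ (abs_nonneg (n' 0 : ℝ))]
  simp only [← abs_mul]
  congr 2
  · linear_combination -h₁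
  · linear_combination h₂

lemma formHeight_mul_formDist {n n' : Fin 3 → ℤ} (h : n ⨯₃ n' = 0) :
    formHeight n * formDist ξ₁ ξ₂ n' = formHeight n' * formDist ξ₁ ξ₂ n := by
  obtain ⟨h₀, h₂, h₁⟩ := cross_eq_zero_iff.mp h
  rify at h₀ h₁ h₂
  rw [formHeight, formHeight, formDist, formDist,
    max_mul_of_nonneg _ _ (abs_nonneg (n' 0 + n' 1 * ξ₁ + n' 2 * ξ₂ : ℝ)),
    max_mul_of_nonneg _ _ (abs_nonneg (n 0 + n 1 * ξ₁ + n 2 * ξ₂ : ℝ))]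
  simp only [← abs_mul]
  congr 2
  · linear_combination -h₁ + ξ₂ * h₀
  · linear_combination h₂ - ξ₁ * h₀

end

namespace IsEnvelope
variable {ι : Type*} {X Y : ι → ℝ} {g : ℕ → ℤ}

lemma exp_lt_max (h : IsEnvelope (fun i => ceilLog (max 1 (X i))) (fun i => ceilLog (Y i)) g)
    (hXY : ∀ i, IsSizePair (X i) (Y i)) (k : ℕ) (i : ι) :
    Real.exp (3 * g k - 3) < max (X i * Real.exp (-3 * k)) (Y i) := by
  refine lt_of_le_of_lt ?_ ((hXY i).exp_lt_max k)
  have := h.le k i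
  gcongr

/-- At a kink of the envelope there are two minimal points which are not proportional. -/
lemma exists_of_kink_of_isSizePair
    (h : IsEnvelope (fun i => ceilLog (max 1 (X i))) (fun i => ceilLog (Y i)) g)
    (hXY : ∀ i, IsSizePair (X i) (Y i)) (k : ℕ) (h₁ : g (k + 1) = g k)
    (h₂ : g (k + 2) = g (k + 1) - 1) :
    ∃ i j, X i * Y j ≠ X j * Y i ∧
      max (X i * Real.exp (-3 * (k + 1 : ℕ))) (Y i) ≤ Real.exp (3 * g (k + 1)) ∧
      max (X j * Real.exp (-3 * (k + 1 : ℕ))) (Y j) ≤ Real.exp (3 * g (k + 1)) := by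
  obtain ⟨i, j, hX, hY, hi, hj⟩ := h.exists_of_kink k h₁ h₂
  refine ⟨i, j, ?_, ((hXY i).max_le_exp _).trans (by gcongr), ((hXY j).max_le_exp _).trans (by gcongr)⟩
  have hY' := lt_of_ceilLog_lt (hXY j).pos hY
  have hX' := lt_of_ceilLog_lt (lt_max_of_lt_left one_pos) hX
  have hX'' : X j < X i := by
    rcases lt_max_iff.mp hX' with h' | h'
    · exact absurd ((le_max_left _ _).trans_lt h') (lt_irrefl _)
    · exact (le_max_right _ _).trans_lt h'
  exact (mul_lt_mul' hX''.le hY' (hXY i).pos.le ((hXY j).nonneg.trans_lt hX'')).ne'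

end IsEnvelope

/-- `g` and `g'` are the envelopes of the logarithmic sizes of the nonzero lattice points and of the
nonzero points of the dual lattice. -/
structure IsEnvelopePair (ξ₁ ξ₂ : ℝ) (g g' : ℕ → ℤ) : Prop where
  point : IsEnvelope (fun n : {n : Fin 3 → ℤ // n ≠ 0} => ceilLog (max 1 |(n.1 0 : ℝ)|))
    (fun n => ceilLog (pointDist ξ₁ ξ₂ n.1)) g
  form : IsEnvelope (fun m : {m : Fin 3 → ℤ // m ≠ 0} => ceilLog (max 1 (formHeight m.1)))
    (fun m => ceilLog (formDist ξ₁ ξ₂ m.1)) g'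

lemma exists_isEnvelopePair (ξ₁ ξ₂ : ℝ) : ∃ g g', IsEnvelopePair ξ₁ ξ₂ g g' := by
  have : Nonempty {n : Fin 3 → ℤ // n ≠ 0} := nonempty_subtype.mpr (exists_ne 0)
  obtain ⟨g, hg⟩ := exists_isEnvelope
    (α := fun n : {n : Fin 3 → ℤ // n ≠ 0} => ceilLog (max 1 |(n.1 0 : ℝ)|))
    (fun n => ceilLog (pointDist ξ₁ ξ₂ n.1)) fun n => ceilLog_nonneg (le_max_left _ _)
  obtain ⟨g', hg'⟩ := exists_isEnvelope
    (α := fun m : {m : Fin 3 → ℤ // m ≠ 0} => ceilLog (max 1 (formHeight m.1)))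
    (fun m => ceilLog (formDist ξ₁ ξ₂ m.1)) fun m => ceilLog_nonneg (le_max_left _ _)
  exact ⟨g, g', hg, hg'⟩

lemma two_lt_exp_one : (2 : ℝ) < Real.exp 1 := by linarith [Real.exp_one_gt_d9]

lemma three_lt_exp_two : (3 : ℝ) < Real.exp 2 := by
  have : Real.exp 2 = Real.exp 1 ^ 2 := by rw [← Real.exp_nat_mul]; norm_num
  nlinarith [two_lt_exp_one]

namespace IsEnvelopePair
open Matrix
variable {ξ₁ ξ₂ : ℝ} {g g' : ℕ → ℤ}

lemma neg_le_point (h : IsEnvelopePair ξ₁ ξ₂ g g') (k : ℕ) : -(k : ℤ) ≤ g k :=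
  h.point.neg_le (fun _ => ceilLog_nonneg (le_max_left _ _)) k

lemma neg_le_form (h : IsEnvelopePair ξ₁ ξ₂ g g') (k : ℕ) : -(k : ℤ) ≤ g' k :=
  h.form.neg_le (fun _ => ceilLog_nonneg (le_max_left _ _)) k

lemma norm_latticeVec_le {n : Fin 3 → ℤ} {k : ℕ} {x : ℝ}
    (h : max (|(n 0 : ℝ)| * Real.exp (-3 * k)) (pointDist ξ₁ ξ₂ n) ≤ Real.exp x) :
    ‖latticeVec ξ₁ ξ₂ (Real.exp k) n‖ ≤ Real.exp (x + k) := by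
  rw [norm_latticeVec, add_comm, Real.exp_add]
  gcongr

lemma norm_dualVec_le {m : Fin 3 → ℤ} {k : ℕ} {x : ℝ}
    (h : max (formHeight m * Real.exp (-3 * k)) (formDist ξ₁ ξ₂ m) ≤ Real.exp x) :
    ‖dualVec ξ₁ ξ₂ (Real.exp k) m‖ ≤ Real.exp (x + 2 * k) := by
  rw [norm_dualVec, add_comm, Real.exp_add]
  gcongr

lemma exp_lt_norm_latticeVec (h : IsEnvelopePair ξ₁ ξ₂ g g')
    (hind : LinearIndependent ℚ ![(1 : ℝ), ξ₁, ξ₂]) (k : ℕ) {n : Fin 3 → ℤ}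
    (hn : n ≠ 0) : Real.exp (3 * g k + k - 3) < ‖latticeVec ξ₁ ξ₂ (Real.exp k) n‖ := by
  rw [norm_latticeVec, show (3 * g k + k - 3 : ℝ) = k + (3 * g k - 3) by ring, Real.exp_add]
  gcongr
  exact h.point.exp_lt_max (fun n => isSizePair_pointDist hind n.2) k ⟨n, hn⟩

lemma exp_lt_norm_dualVec (h : IsEnvelopePair ξ₁ ξ₂ g g')
    (hind : LinearIndependent ℚ ![(1 : ℝ), ξ₁, ξ₂]) (k : ℕ) {m : Fin 3 → ℤ}
    (hm : m ≠ 0) : Real.exp (3 * g' k + 2 * k - 3) < ‖dualVec ξ₁ ξ₂ (Real.exp k) m‖ := by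
  rw [norm_dualVec, show (3 * g' k + 2 * k - 3 : ℝ) = 2 * k + (3 * g' k - 3) by ring, Real.exp_add]
  gcongr
  exact h.form.exp_lt_max (fun m => isSizePair_formDist hind m.2) k ⟨m, hm⟩

lemma exists_norm_latticeVec_le (h : IsEnvelopePair ξ₁ ξ₂ g g')
    (hind : LinearIndependent ℚ ![(1 : ℝ), ξ₁, ξ₂]) (k : ℕ) :
    ∃ n ≠ 0, ‖latticeVec ξ₁ ξ₂ (Real.exp k) n‖ ≤ Real.exp (3 * g k + k) := by
  obtain ⟨n, hn⟩ := h.point.exists_eq k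
  exact ⟨n, n.2, norm_latticeVec_le (by
    simpa only [hn] using (isSizePair_pointDist hind n.2).max_le_exp k)⟩

lemma exists_norm_dualVec_le (h : IsEnvelopePair ξ₁ ξ₂ g g')
    (hind : LinearIndependent ℚ ![(1 : ℝ), ξ₁, ξ₂]) (k : ℕ) :
    ∃ m ≠ 0, ‖dualVec ξ₁ ξ₂ (Real.exp k) m‖ ≤ Real.exp (3 * g' k + 2 * k) := by
  obtain ⟨m, hm⟩ := h.form.exists_eq k
  exact ⟨m, m.2, norm_dualVec_le (by
    simpa only [hm] using (isSizePair_formDist hind m.2).max_le_exp k)⟩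

lemma norm_cross_le_exp {u v : Fin 3 → ℝ} {x y : ℝ} (hu : ‖u‖ ≤ Real.exp x)
    (hv : ‖v‖ ≤ Real.exp y) : ‖u ⨯₃ v‖ ≤ Real.exp (x + y + 1) := by
  calc _ ≤ 2 * (‖u‖ * ‖v‖) := norm_cross_le u v
    _ ≤ Real.exp 1 * (Real.exp x * Real.exp y) := by gcongr; exact two_lt_exp_one.le
    _ = _ := by rw [← Real.exp_add, ← Real.exp_add]; ring_nf

/-- A lattice point and a dual lattice point which are both small are orthogonal. -/
lemma nonneg_of_dotProduct_ne_zero {e x y : ℝ} (he : e ≠ 0) {n m : Fin 3 → ℤ} (h : n ⬝ᵥ m ≠ 0)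
    (hn : ‖latticeVec ξ₁ ξ₂ e n‖ ≤ Real.exp x) (hm : ‖dualVec ξ₁ ξ₂ e m‖ ≤ Real.exp y) :
    0 ≤ x + y + 2 := by
  have h₁ := abs_dotProduct_le (latticeVec ξ₁ ξ₂ e n) (dualVec ξ₁ ξ₂ e m)
  rw [latticeVec_dotProduct_dualVec he] at h₁
  rw [← Real.one_le_exp_iff]
  calc _ ≤ _ := one_le_abs_intCast h
    _ ≤ _ := h₁
    _ ≤ Real.exp 2 * (Real.exp x * Real.exp y) := by gcongr; exact three_lt_exp_two.le
    _ = _ := by rw [← Real.exp_add, ← Real.exp_add]; ring_nf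

lemma kink_point (h : IsEnvelopePair ξ₁ ξ₂ g g')
    (hind : LinearIndependent ℚ ![(1 : ℝ), ξ₁, ξ₂]) (k : ℕ) (h₁ : g (k + 1) = g k)
    (h₂ : g (k + 2) = g (k + 1) - 1) : g' (k + 1) ≤ 2 * g (k + 1) + 1 := by
  obtain ⟨n, n', hne, hn, hn'⟩ := h.point.exists_of_kink_of_isSizePair
    (fun n => isSizePair_pointDist hind n.2) k h₁ h₂
  have h₃ := norm_cross_le_exp (norm_latticeVec_le hn) (norm_latticeVec_le hn')
  rw [latticeVec_cross (Real.exp_pos _).ne'] at h₃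
  have h₄ := Real.exp_lt_exp.mp ((h.exp_lt_norm_dualVec hind (k + 1)
    fun h' => hne (abs_mul_pointDist h')).trans_le h₃)
  have : 3 * g' (k + 1) - 3 < 6 * g (k + 1) + 1 := by
    rify
    linarith
  omega

lemma kink_form (h : IsEnvelopePair ξ₁ ξ₂ g g')
    (hind : LinearIndependent ℚ ![(1 : ℝ), ξ₁, ξ₂]) (k : ℕ) (h₁ : g' (k + 1) = g' k)
    (h₂ : g' (k + 2) = g' (k + 1) - 1) : g (k + 1) ≤ 2 * g' (k + 1) + (k + 1) + 1 := by
  obtain ⟨m, m', hne, hm, hm'⟩ := h.form.exists_of_kink_of_isSizePair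
    (fun m => isSizePair_formDist hind m.2) k h₁ h₂
  have h₃ := norm_cross_le_exp (norm_dualVec_le hm) (norm_dualVec_le hm')
  rw [dualVec_cross (Real.exp_pos _).ne'] at h₃
  have h₄ := Real.exp_lt_exp.mp ((h.exp_lt_norm_latticeVec hind (k + 1)
    fun h' => hne (formHeight_mul_formDist h')).trans_le h₃)
  have : 3 * g (k + 1) - 3 < 6 * g' (k + 1) + 3 * (k + 1) + 1 := by
    rify
    push_cast at h₄
    linarith
  omega

/-- If the first envelope decreases just after the second one is stationary, then the
corresponding minimal points are not orthogonal. -/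
lemma le_add_of_decrease (h : IsEnvelopePair ξ₁ ξ₂ g g')
    (hind : LinearIndependent ℚ ![(1 : ℝ), ξ₁, ξ₂]) (k : ℕ) (h₁ : g' (k + 1) = g' k)
    (h₂ : g (k + 3) = g (k + 2) - 1) : -2 ≤ g (k + 2) + g' k + k := by
  obtain ⟨⟨n, hn0⟩, hα, hβ⟩ := h.point.exists_of_decrease (k + 2) h₂
  obtain ⟨⟨m, hm0⟩, hβ', hα'⟩ := h.form.exists_of_constant k h₁
  have hn := isSizePair_pointDist hind hn0
  have hm := isSizePair_formDist hind hm0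
  simp only at hα hβ hβ' hα'
  have hnle := norm_latticeVec_le ((hn.max_le_exp k).trans (Real.exp_le_exp.mpr
    (show _ ≤ (3 * (g (k + 2) + 2 : ℤ) : ℝ) by gcongr; push_cast at hα; omega)))
  have hmle := norm_dualVec_le ((hm.max_le_exp k).trans (Real.exp_le_exp.mpr
    (show _ ≤ (3 * g' k : ℝ) by gcongr; omega)))
  have hX : 1 ≤ |(n 0 : ℝ)| := by
    rcases hn.cases with ⟨h0, h1⟩ | h1
    · have := ceilLog_nonneg h1
      rw [h0] at hα
      have h₄ : ceilLog (max 1 0) = 0 := by simp [ceilLog]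
      push_cast at hα
      omega
    · exact h1
  rw [max_eq_right hX] at hα
  have hX' : Real.exp (3 * (g (k + 2) + k + 1)) < |(n 0 : ℝ)| := by
    convert exp_ceilLog_lt (x := |(n 0 : ℝ)|) (by linarith) using 2
    rw [hα]
    push_cast
    ring
  have hY : pointDist ξ₁ ξ₂ n ≤ Real.exp (3 * (g (k + 2) - 1)) :=
    (le_exp_ceilLog hn.pos).trans (by gcongr; exact_mod_cast hβ)
  have hY' : Real.exp (3 * (g' k - 1)) < formDist ξ₁ ξ₂ m := by
    convert exp_ceilLog_lt hm.pos using 2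
    rw [hβ']
    ring
  have hX'' : formHeight m ≤ Real.exp (3 * (g' k + k)) :=
    ((le_max_right 1 _).trans (le_exp_ceilLog (lt_max_of_lt_left one_pos))).trans
      (by gcongr; exact_mod_cast hα')
  have hnm : n ⬝ᵥ m ≠ 0 := by
    intro h0
    have h0' : (n 0 * (m 0 + m 1 * ξ₁ + m 2 * ξ₂) : ℝ) =
        m 1 * (ξ₁ * n 0 - n 1) + m 2 * (ξ₂ * n 0 - n 2) := by
      rw [vec3_dotProduct] at h0
      rify at h0
      linear_combination h0
    have hle : |(n 0 : ℝ)| * formDist ξ₁ ξ₂ m ≤ 2 * (formHeight m * pointDist ξ₁ ξ₂ n) := by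
      rw [formDist, ← abs_mul, h0', two_mul]
      refine (abs_add_le _ _).trans ?_
      rw [abs_mul, abs_mul]
      have := hm.nonneg
      gcongr
      · exact le_max_left _ _
      · exact le_max_left _ _
      · exact le_max_right _ _
      · exact le_max_right _ _
    refine hle.not_gt ?_
    calc 2 * (formHeight m * pointDist ξ₁ ξ₂ n)
        ≤ Real.exp 1 * (Real.exp (3 * (g' k + k)) * Real.exp (3 * (g (k + 2) - 1))) := by
          have := mul_nonneg hm.nonneg hn.pos.le
          have := hn.pos
          gcongr
          exact two_lt_exp_one.le
      _ ≤ Real.exp (3 * (g (k + 2) + k + 1)) * Real.exp (3 * (g' k - 1)) := by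
          simp only [← Real.exp_add]
          rw [Real.exp_le_exp]
          linarith
      _ < _ := by gcongr
  have := nonneg_of_dotProduct_ne_zero (Real.exp_pos k).ne' hnm hnle hmle
  have : 0 ≤ 3 * (g (k + 2) + 2) + k + (3 * g' k + 2 * k) + 2 := by exact_mod_cast this
  omega

/-- The first minimum is governed by the first envelope, the last one by the second envelope. -/
lemma minimalTriple_bounds (h : IsEnvelopePair ξ₁ ξ₂ g g')
    (hind : LinearIndependent ℚ ![(1 : ℝ), ξ₁, ξ₂]) (k : ℕ) {n : Fin 3 → Fin 3 → ℤ}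
    {r : Fin 3 → ℤ} (hr : IsMinimalTriple (fun n => ‖latticeVec ξ₁ ξ₂ (Real.exp k) n‖) n r) :
    r 0 ≤ 3 * g k + k ∧ 3 * g k + k ≤ r 0 + 2 ∧ 3 * g' k + 2 * k ≤ r 0 + r 1 + 3 ∧
      -(3 * g' k + 2 * k) ≤ r 2 + 2 := by
  have he := (Real.exp_pos k).ne'
  refine ⟨?_, ?_, ?_, ?_⟩
  · obtain ⟨m, hm, hm'⟩ := h.exists_norm_latticeVec_le hind k
    exact IsMinimalTriple.le_of_lt_exp (hr.lt_of_ne_zero m hm) (by push_cast; exact hm')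
  · have := Real.exp_lt_exp.mp ((h.exp_lt_norm_latticeVec hind k hr.ne_zero).trans_le (hr.le_exp 0))
    have : 3 * g k + k - 3 < r 0 := by exact_mod_cast this
    omega
  · have h₃ := norm_cross_le_exp (hr.le_exp 0) (hr.le_exp 1)
    rw [latticeVec_cross he] at h₃
    have := Real.exp_lt_exp.mp ((h.exp_lt_norm_dualVec hind k hr.cross_ne_zero).trans_le h₃)
    have : 3 * g' k + 2 * k - 3 < r 0 + r 1 + 1 := by exact_mod_cast this
    omega
  · obtain ⟨m, hm, hm'⟩ := h.exists_norm_dualVec_le hind k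
    obtain ⟨i, hi⟩ := hr.exists_dotProduct_ne_zero hm
    have := nonneg_of_dotProduct_ne_zero he hi (hr.le_exp i) hm'
    have : 0 ≤ r i + (3 * g' k + 2 * k) + 2 := by exact_mod_cast this
    have := hr.zero_le_one
    have := hr.one_le_two
    fin_cases i <;> simp at * <;> omega

end IsEnvelopePair

section
open Matrix

lemma eq_latticeVec_one_of_mem {ξ₁ ξ₂ : ℝ} {v : Fin 3 → ℝ} (hv : v ∈ LatticeSet ξ₁ ξ₂) :
    ∃ n : Fin 3 → ℤ, v = latticeVec ξ₁ ξ₂ 1 n := by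
  obtain ⟨x, y₁, y₂, h₀, h₁, h₂⟩ := hv
  refine ⟨![x, y₁, y₂], ?_⟩
  ext i
  fin_cases i <;> simp [latticeVec, h₀, h₁, h₂]

lemma latticeVec_one_mem (ξ₁ ξ₂ : ℝ) (n : Fin 3 → ℤ) :
    latticeVec ξ₁ ξ₂ 1 n ∈ LatticeSet ξ₁ ξ₂ :=
  ⟨n 0, n 1, n 2, by simp [latticeVec], by simp [latticeVec], by simp [latticeVec]⟩

lemma mem_smul_Box_iff {l q : ℝ} (hl : 0 < l) {v : Fin 3 → ℝ} : v ∈ l • Box q ↔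
    |v 0| ≤ l * Real.exp (2 * q) ∧ |v 1| ≤ l * Real.exp (-q) ∧ |v 2| ≤ l * Real.exp (-q) := by
  rw [Set.mem_smul_set_iff_inv_smul_mem₀ hl.ne']
  simp only [Box, Set.mem_ofPred_eq, Pi.smul_apply, smul_eq_mul, abs_mul, abs_inv, abs_of_pos hl,
    inv_mul_le_iff₀ hl]

variable {ξ₁ ξ₂ q l : ℝ} {k : ℕ}

lemma norm_latticeVec_le_of_mem_smul_Box (hl : 0 < l) (hq : q ≤ k + 1) (hk : k ≤ q)
    {n : Fin 3 → ℤ} (h : latticeVec ξ₁ ξ₂ 1 n ∈ l • Box q) :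
    ‖latticeVec ξ₁ ξ₂ (Real.exp k) n‖ ≤ l * Real.exp 2 := by
  rw [mem_smul_Box_iff hl] at h
  simp only [latticeVec, cons_val, one_pow, div_one, mul_one] at h
  obtain ⟨h₀, h₁, h₂⟩ := h
  have key : ∀ x : ℝ, |x| ≤ l * Real.exp (-q) → |x * Real.exp k| ≤ l * Real.exp 2 := by
    intro x hx
    rw [abs_mul, Real.abs_exp]
    calc _ ≤ l * Real.exp (-q) * Real.exp k := by gcongr
      _ = l * Real.exp (-q + k) := by rw [mul_assoc, ← Real.exp_add]
      _ ≤ _ := by gcongr; linarith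
  rw [latticeVec, norm_cons_three]
  refine max_le ?_ (max_le (key _ h₁) (key _ h₂))
  rw [abs_div, abs_pow, Real.abs_exp, div_le_iff₀ (by positivity)]
  calc _ ≤ l * Real.exp (2 * q) := h₀
    _ ≤ l * Real.exp (2 + 2 * k) := by gcongr; linarith
    _ = _ := by rw [Real.exp_add, mul_assoc, ← Real.exp_nat_mul]; norm_cast

lemma mem_smul_Box_of_norm_latticeVec_le (hl : 0 < l) (hq : q ≤ k + 1) (hk : k ≤ q)
    {n : Fin 3 → ℤ} (h : ‖latticeVec ξ₁ ξ₂ (Real.exp k) n‖ ≤ l) :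
    latticeVec ξ₁ ξ₂ 1 n ∈ (l * Real.exp 1) • Box q := by
  rw [mem_smul_Box_iff (by positivity)]
  simp only [latticeVec, cons_val, one_pow, div_one, mul_one]
  rw [latticeVec, norm_cons_three, max_le_iff, max_le_iff] at h
  obtain ⟨h₀, h₁, h₂⟩ := h
  have key : ∀ x : ℝ, |x * Real.exp k| ≤ l → |x| ≤ l * Real.exp 1 * Real.exp (-q) := by
    intro x hx
    rw [abs_mul, Real.abs_exp] at hx
    calc |x| = |x| * Real.exp k * Real.exp (-k) := by rw [mul_assoc, ← Real.exp_add]; simp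
      _ ≤ l * Real.exp (1 + -q) := by gcongr; linarith
      _ = _ := by rw [Real.exp_add, mul_assoc]
  refine ⟨?_, key _ h₁, key _ h₂⟩
  rw [abs_div, abs_pow, Real.abs_exp, div_le_iff₀ (by positivity)] at h₀
  refine h₀.trans ?_
  rw [mul_assoc, ← Real.exp_add, ← Real.exp_nat_mul]
  gcongr
  push_cast
  linarith

lemma linearIndependent_of_triple_ne_zero {u : Fin 3 → Fin 3 → ℝ}
    (h : u 0 ⬝ᵥ u 1 ⨯₃ u 2 ≠ 0) : LinearIndependent ℝ u := by
  apply Matrix.linearIndependent_rows_of_det_ne_zero (A := Matrix.of u)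
  have hu : ![u 0, u 1, u 2] = u := List.ofFn_inj.mp rfl
  rwa [triple_product_eq_det, hu] at h

lemma eq_zero_of_cross_eq_zero {u c : Fin 3 → ℝ} (hu : u ≠ 0) (h₁ : u ⨯₃ c = 0)
    (h₂ : u ⬝ᵥ c = 0) : c = 0 := by
  have := cross_dot_cross u c u c
  rw [h₁, h₂, zero_dotProduct, zero_mul, sub_zero, eq_comm, mul_eq_zero] at this
  exact dotProduct_self_eq_zero.mp (this.resolve_left fun h => hu (dotProduct_self_eq_zero.mp h))

lemma not_linearIndependent_of_cross_eq_zero {u : Fin 3 → ℝ} (hu : u ≠ 0) {v : Fin 2 → Fin 3 → ℝ}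
    (hv : ∀ i, u ⨯₃ v i = 0) : ¬ LinearIndependent ℝ v := by
  intro h
  have h' : v 0 ⨯₃ v 1 ≠ 0 := by
    have hv : ![v 0, v 1] = v := List.ofFn_inj.mp rfl
    rwa [crossProduct_ne_zero_iff_linearIndependent, hv]
  refine h' (eq_zero_of_cross_eq_zero hu ?_ ?_)
  · rw [leibniz_cross, hv, hv]
    simp
  · rw [triple_product_permutation, ← cross_anticomm, hv]
    simp

lemma not_linearIndependent_of_dotProduct_eq_zero {u : Fin 3 → ℝ} (hu : u ≠ 0)
    {v : Fin 3 → Fin 3 → ℝ} (hv : ∀ i, v i ⬝ᵥ u = 0) : ¬ LinearIndependent ℝ v := by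
  intro h
  have := Matrix.linearIndependent_rows_iff_isUnit (A := Matrix.of v).mp h
  have hdet : (Matrix.of v).det ≠ 0 := ((Matrix.isUnit_iff_isUnit_det _).mp this).ne_zero
  exact hu (Matrix.eq_zero_of_mulVec_eq_zero hdet (funext hv))

namespace IsMinimalTriple
variable {N : (Fin 3 → ℤ) → ℝ} {n : Fin 3 → Fin 3 → ℤ} {r : Fin 3 → ℤ}

lemma monotone (h : IsMinimalTriple N n r) : Monotone r := by
  have := h.zero_le_one
  have := h.one_le_two
  intro i j hij
  fin_cases i <;> fin_cases j <;> simp at hij ⊢ <;> omega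

lemma triple_latticeVec_ne_zero (h : IsMinimalTriple N n r) :
    latticeVec ξ₁ ξ₂ 1 (n 2) ⬝ᵥ (latticeVec ξ₁ ξ₂ 1 (n 0) ⨯₃ latticeVec ξ₁ ξ₂ 1 (n 1)) ≠ 0 := by
  rw [latticeVec_cross one_ne_zero, latticeVec_dotProduct_dualVec one_ne_zero, dotProduct_comm]
  exact_mod_cast h.triple_ne_zero

lemma linearIndependent_latticeVec (h : IsMinimalTriple N n r) :
    LinearIndependent ℝ fun i => latticeVec ξ₁ ξ₂ 1 (n i) := by
  apply linearIndependent_of_triple_ne_zero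
  rw [triple_product_permutation, triple_product_permutation]
  exact h.triple_latticeVec_ne_zero

/-- A linearly independent family of lattice points has a member which is not small. -/
lemma exists_exp_lt (h : IsMinimalTriple N n r) (j : Fin 3) {m : Fin (j + 1) → Fin 3 → ℤ}
    (hm : LinearIndependent ℝ fun i => latticeVec ξ₁ ξ₂ 1 (m i)) :
    ∃ i, Real.exp (r j - 1) < N (m i) := by
  have hne := h.triple_latticeVec_ne_zero (ξ₁ := ξ₁) (ξ₂ := ξ₂)
  have dual_zero : dualVec ξ₁ ξ₂ 1 0 = 0 := by
    ext i
    fin_cases i <;> simp [dualVec]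
  fin_cases j
  · refine ⟨0, h.lt_of_ne_zero _ fun h0 => hm.ne_zero 0 ?_⟩
    rw [h0]
    ext i
    fin_cases i <;> simp [latticeVec]
  · by_contra! hle
    refine not_linearIndependent_of_cross_eq_zero (u := latticeVec ξ₁ ξ₂ 1 (n 0)) ?_ (fun i => ?_) hm
    · intro h0
      simp [h0] at hne
    · rw [latticeVec_cross one_ne_zero, not_imp_comm.mp (h.lt_of_cross_ne_zero _) (hle i).not_gt,
        dual_zero]
  · by_contra! hle
    refine not_linearIndependent_of_dotProduct_eq_zero
      (u := dualVec ξ₁ ξ₂ 1 (n 0 ⨯₃ n 1)) ?_ (fun i => ?_) hm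
    · intro h0
      rw [latticeVec_cross one_ne_zero, h0] at hne
      simp at hne
    · rw [latticeVec_dotProduct_dualVec one_ne_zero, dotProduct_comm,
        not_imp_comm.mp (h.lt_of_triple_ne_zero _) (hle i).not_gt, Int.cast_zero]

lemma abs_Lmin_sub_le (h : IsMinimalTriple (fun n => ‖latticeVec ξ₁ ξ₂ (Real.exp k) n‖) n r)
    (hq : q ≤ k + 1) (hk : k ≤ q) (j : Fin 3) : |Lmin ξ₁ ξ₂ (j + 1) q - r j| ≤ 3 := by
  set S := {l : ℝ | 0 < l ∧ ∃ v : Fin (j + 1) → (Fin 3 → ℝ), LinearIndependent ℝ v ∧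
    ∀ i, v i ∈ LatticeSet ξ₁ ξ₂ ∧ v i ∈ l • Box q} with hS
  have hmem : Real.exp (r j) * Real.exp 1 ∈ S := by
    refine ⟨by positivity, fun i => latticeVec ξ₁ ξ₂ 1 (n (Fin.castLE j.2 i)),
      h.linearIndependent_latticeVec.comp _ (Fin.castLE_injective _), fun i =>
      ⟨latticeVec_one_mem _ _ _, mem_smul_Box_of_norm_latticeVec_le (Real.exp_pos _) hq hk ?_⟩⟩
    refine (h.le_exp _).trans ?_
    have : r (Fin.castLE j.2 i) ≤ r j := h.monotone (Fin.le_def.mpr (Nat.lt_succ_iff.mp i.2))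
    gcongr
  have hlow : ∀ l ∈ S, Real.exp (r j - 3) ≤ l := by
    rintro l ⟨hl, v, hv, hv'⟩
    choose m hm using fun i => eq_latticeVec_one_of_mem (hv' i).1
    obtain rfl : v = fun i => latticeVec ξ₁ ξ₂ 1 (m i) := funext hm
    obtain ⟨i, hi⟩ := h.exists_exp_lt j hv
    have := hi.le.trans (norm_latticeVec_le_of_mem_smul_Box hl hq hk (hv' i).2)
    rw [show (r j - 1 : ℝ) = (r j - 3) + 2 by ring, Real.exp_add] at this
    exact le_of_mul_le_mul_right this (Real.exp_pos 2)
  have h₁ : lambdaMin ξ₁ ξ₂ (j + 1) q ≤ Real.exp (r j + 1) := by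
    rw [Real.exp_add]
    exact csInf_le ⟨_, hlow⟩ hmem
  have h₂ : Real.exp (r j - 3) ≤ lambdaMin ξ₁ ξ₂ (j + 1) q := le_csInf ⟨_, hmem⟩ hlow
  have hpos := (Real.exp_pos _).trans_le h₂
  rw [← Real.log_le_iff_le_exp hpos] at h₁
  rw [← Real.le_log_iff_exp_le hpos] at h₂
  rw [Lmin, abs_le]
  constructor <;> linarith

end IsMinimalTriple

end

lemma abs_pathInterp_sub_le {l : ℕ → Fin 3 → ℤ} {k : ℕ} {j : Fin 3}
    (h : l (k + 1) j = l k j ∨ l (k + 1) j = l k j + 1) {q : ℝ}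
    (hq : q ∈ Set.Icc (k : ℝ) (k + 1 : ℕ)) : |pathInterp l j q - (k - 3 * l k j)| ≤ 2 := by
  rw [pathInterp_of_mem_Icc l j k hq, pathSlope, add_sub_cancel_left, abs_le]
  obtain ⟨h₁, h₂⟩ := hq
  push_cast at h₂
  rcases h with h | h <;> rw [h] <;> push_cast <;> constructor <;> linarith

/-- The target sequences attached to a pair of envelopes. -/
lemma IsEnvelopePair.isTarget {ξ₁ ξ₂ : ℝ} {g g' : ℕ → ℤ} (h : IsEnvelopePair ξ₁ ξ₂ g g')
    (hind : LinearIndependent ℚ ![(1 : ℝ), ξ₁, ξ₂]) :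
    IsTarget (fun k => -g (k + 2) - 5) (fun k => k + g' k + 5) where
  step_a k := by
    have := h.point.step (k + 2)
    rw [show k + 1 + 2 = k + 2 + 1 from rfl]
    omega
  step_c k := by
    have := h.form.step k
    push_cast
    omega
  kink_a k h₁ h₂ := by
    have := h.kink_point hind (k + 2)
    have := h.form.step (k + 1)
    have := h.form.step (k + 2)
    simp only [Nat.add_assoc, Nat.reduceAdd] at *
    push_cast
    omega
  kink_c k h₁ h₂ := by
    have := h.kink_form hind k
    have := h.point.step (k + 1)
    have := h.point.step (k + 2)
    simp only [Nat.add_assoc, Nat.reduceAdd] at *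
    push_cast at *
    omega
  both k h₁ h₂ := by
    have := h.le_add_of_decrease hind k
    simp only [Nat.add_assoc, Nat.reduceAdd] at *
    push_cast at *
    omega
  zero_a := by
    have := h.neg_le_point 2
    simp only [Nat.zero_add]
    push_cast at this
    omega
  zero_c := by
    have := h.neg_le_form 0
    push_cast at *
    omega

/-- At integer points the system attached to the envelopes stays close to the minima. -/
lemma IsEnvelopePair.abs_partRows_sub_le {ξ₁ ξ₂ : ℝ} {g g' : ℕ → ℤ}
    (h : IsEnvelopePair ξ₁ ξ₂ g g') (hind : LinearIndependent ℚ ![(1 : ℝ), ξ₁, ξ₂]) (k : ℕ)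
    {n : Fin 3 → Fin 3 → ℤ} {r : Fin 3 → ℤ}
    (hr : IsMinimalTriple (fun n => ‖latticeVec ξ₁ ξ₂ (Real.exp k) n‖) n r) (j : Fin 3) :
    |(k : ℤ) - 3 * partRows (fun k => -g (k + 2) - 5) (fun k => k + g' k + 5) k j - r j| ≤ 60 := by
  have := h.minimalTriple_bounds hind k hr
  have := hr.sum_le (Real.exp_pos k).ne'
  have := hr.zero_le_one
  have := hr.one_le_two
  have := h.point.step k
  have := h.point.step (k + 1)
  have ht := topRow_spec (fun k => -g (k + 2) - 5) (fun k => k + g' k + 5) k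
  have hb := botRow_spec (fun k => -g (k + 2) - 5) (fun k => k + g' k + 5) k
  rw [abs_le]
  set t := topRow (fun k => -g (k + 2) - 5) (fun k => k + g' k + 5) k with ht'
  set b := botRow (fun k => -g (k + 2) - 5) (fun k => k + g' k + 5) k with hb'
  simp only [Nat.add_assoc, Nat.reduceAdd] at *
  have h₁ : -5 ≤ t + g k ∧ t + g k ≤ 5 := by omega
  have h₂ : -5 ≤ b - g' k - k ∧ b - g' k - k ≤ 5 := by omega
  fin_cases j <;> simp [partRows, ← ht', ← hb'] <;> omega

/-- Schmidt–Summerer: if `{1, ξ₁, ξ₂}` is linearly independent over `ℚ`, then there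
is a `3`-system `P = (P₁,P₂,P₃)` and a constant `C ≥ 0` with `|P_j(q) - L_j(q)| ≤ C`
for all `q > 0` and `j ∈ {1,2,3}` (here `P_j` is indexed by `Fin 3`). -/
theorem exists_three_system_approximating_L
    (ξ₁ ξ₂ : ℝ) (hind : LinearIndependent ℚ ![(1 : ℝ), ξ₁, ξ₂]) :
    ∃ P : Fin 3 → ℝ → ℝ, IsNSystem 3 P ∧
      ∃ C : ℝ, 0 ≤ C ∧ ∀ q : ℝ, 0 < q → ∀ j : Fin 3,
        |P j q - Lmin ξ₁ ξ₂ ((j : ℕ) + 1) q| ≤ C := by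
  obtain ⟨g, g', h⟩ := exists_isEnvelopePair ξ₁ ξ₂
  have hT := h.isTarget hind
  refine ⟨_, isNSystem_partRows hT, 65, by norm_num, fun q hq j => ?_⟩
  have hk := Nat.floor_le hq.le
  have hk' := (Nat.lt_floor_add_one q).le
  set k := ⌊q⌋₊
  obtain ⟨n, r, hr⟩ := exists_isMinimalTriple (Real.exp_pos (3 * g k + k - 3))
    fun n hn => (h.exp_lt_norm_latticeVec hind k hn).le
  have h₁ := abs_le.mp (abs_pathInterp_sub_le (partRows_step hT k j) ⟨hk, by exact_mod_cast hk'⟩)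
  have h₂ := h.abs_partRows_sub_le hind k hr j
  rify at h₂
  have h₂ := abs_le.mp h₂
  have h₃ := abs_le.mp (hr.abs_Lmin_sub_le hk' hk j)
  rw [abs_le]
  constructor <;> linarith [h₁.1, h₁.2, h₂.1, h₂.2, h₃.1, h₃.2]
end

section
/- Let n ≥ 3 be an integer and for 1 ≤ j ≤ n−1 set ξ_j = Σ_{k=0}^∞ 10^{−(k(n−1)+j)!}. Then φ̲₁ = −(n−1), φ̲₂ = (2−n)/2, φ̲_j = 1 for every j with 3 ≤ j ≤ n, φ̄₁ = (2−n)/2, and φ̄_j = 1 for every j with 2 ≤ j ≤ n. -/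
open Filter Pointwise

/-- The lattice `Λ = {(x, ξ₁x - y₁, …, ξ_{n-1}x - y_{n-1}) : x, yᵢ ∈ ℤ} ⊆ ℝⁿ`
(only the values `ξ 1, …, ξ (n-1)` are relevant). -/
def LatticeSetN (n : ℕ) (ξ : ℕ → ℝ) : Set (Fin n → ℝ) :=
  {p | ∃ x : ℤ, ∃ y : ℕ → ℤ, ∀ i : Fin n,
    p i = if (i : ℕ) = 0 then (x : ℝ) else ξ (i : ℕ) * x - y (i : ℕ)}

/-- The box `K(q) = {(z₀,…,z_{n-1}) : |z₀| ≤ e^{(n-1)q}, |zᵢ| ≤ e^{-q} for i ≥ 1}`. -/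
def BoxN (n : ℕ) (q : ℝ) : Set (Fin n → ℝ) :=
  {z | ∀ i : Fin n, ((i : ℕ) = 0 → |z i| ≤ Real.exp (((n : ℝ) - 1) * q)) ∧
    ((i : ℕ) ≠ 0 → |z i| ≤ Real.exp (-q))}

/-- The `j`-th successive minimum `λ_j(q)` of `K(q)` with respect to `Λ`:
the infimum of all `λ > 0` such that `λ·K(q)` contains `j` linearly independent
points of `Λ`. -/
noncomputable def lambdaMinN (n : ℕ) (ξ : ℕ → ℝ) (j : ℕ) (q : ℝ) : ℝ :=
  sInf {l : ℝ | 0 < l ∧ ∃ v : Fin j → (Fin n → ℝ), LinearIndependent ℝ v ∧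
    ∀ i, v i ∈ LatticeSetN n ξ ∧ v i ∈ l • BoxN n q}

/-- `L_j(q) = log λ_j(q)`. -/
noncomputable def LminN (n : ℕ) (ξ : ℕ → ℝ) (j : ℕ) (q : ℝ) : ℝ :=
  Real.log (lambdaMinN n ξ j q)

/-- `φ̲_j = liminf_{q → ∞} L_j(q)/q`. -/
noncomputable def phiLowN (n : ℕ) (ξ : ℕ → ℝ) (j : ℕ) : ℝ :=
  liminf (fun q : ℝ => LminN n ξ j q / q) atTop

/-- `φ̄_j = limsup_{q → ∞} L_j(q)/q`. -/
noncomputable def phiUpN (n : ℕ) (ξ : ℕ → ℝ) (j : ℕ) : ℝ :=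
  limsup (fun q : ℝ => LminN n ξ j q / q) atTop

/-- The half-widths of the box `K(q)`. -/
noncomputable def boxWidth (n : ℕ) (q : ℝ) (i : Fin n) : ℝ :=
  if (i : ℕ) = 0 then Real.exp (((n : ℝ) - 1) * q) else Real.exp (-q)

lemma boxWidth_pos (n : ℕ) (q : ℝ) (i : Fin n) : 0 < boxWidth n q i := by
  unfold boxWidth; split_ifs <;> exact Real.exp_pos _

lemma prod_boxWidth {n : ℕ} (hn : 1 ≤ n) (q : ℝ) : ∏ i, boxWidth n q i = 1 := by
  obtain ⟨m, rfl⟩ : ∃ m, n = m + 1 := ⟨n - 1, by omega⟩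
  rw [Fin.prod_univ_succ]
  simp only [boxWidth, Fin.val_zero, if_true, Fin.val_succ, Nat.succ_ne_zero, if_false,
    Finset.prod_const, Finset.card_univ, Fintype.card_fin]
  rw [← Real.exp_nat_mul, ← Real.exp_add, Real.exp_eq_one_iff]
  push_cast
  ring

lemma mem_smul_BoxN_iff {n : ℕ} {q l : ℝ} (hl : 0 < l) (v : Fin n → ℝ) :
    v ∈ l • BoxN n q ↔ ∀ i, |v i| ≤ l * boxWidth n q i := by
  rw [Set.mem_smul_set_iff_inv_smul_mem₀ hl.ne']
  have key : ∀ (i : Fin n) (c : ℝ), |(l⁻¹ • v) i| ≤ c ↔ |v i| ≤ l * c := by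
    intro i c
    rw [Pi.smul_apply, smul_eq_mul, abs_mul, abs_of_pos (inv_pos.2 hl), inv_mul_le_iff₀ hl]
  simp only [BoxN, Set.mem_ofPred_eq, key]
  refine forall_congr' fun i => ?_
  unfold boxWidth
  split_ifs with h <;> simp [h]

/-- The set of all `l > 0` such that `l • K(q)` contains `j` independent points of the lattice. -/
def admissible (n : ℕ) (ξ : ℕ → ℝ) (q : ℝ) (j : ℕ) : Set ℝ :=
  {l : ℝ | 0 < l ∧ ∃ v : Fin j → (Fin n → ℝ), LinearIndependent ℝ v ∧
    ∀ i, v i ∈ LatticeSetN n ξ ∧ v i ∈ l • BoxN n q}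

lemma bddBelow_admissible (n : ℕ) (ξ : ℕ → ℝ) (q : ℝ) (j : ℕ) :
    BddBelow (admissible n ξ q j) := ⟨0, fun _ h => h.1.le⟩

lemma admissible_anti (n : ℕ) (ξ : ℕ → ℝ) (q : ℝ) {i j : ℕ} (h : i ≤ j) :
    admissible n ξ q j ⊆ admissible n ξ q i := by
  rintro l ⟨hl, v, hv, hm⟩
  exact ⟨hl, v ∘ Fin.castLE h, hv.comp _ (Fin.castLE_injective h), fun k => hm _⟩

lemma exp_mem_admissible {n : ℕ} (ξ : ℕ → ℝ) {q : ℝ} (hn : 1 ≤ n) (hq : 0 ≤ q) :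
    Real.exp q ∈ admissible n ξ q n := by
  let A : Matrix (Fin n) (Fin n) ℝ := fun i j =>
    if (i : ℕ) = 0 then (if (j : ℕ) = 0 then 1 else Int.fract (ξ j)) else if i = j then 1 else 0
  have hA : A.det ≠ 0 := by
    have hT : A.BlockTriangular id := by
      intro i j hij
      have hij' : (j : ℕ) < i := hij
      have h1 : (i : ℕ) ≠ 0 := by omega
      have h2 : i ≠ j := by rintro rfl; omega
      simp [A, h1, h2]
    rw [Matrix.det_of_isUpperTriangular hT]
    refine Finset.prod_ne_zero_iff.2 fun i _ => ?_
    by_cases h : (i : ℕ) = 0 <;> simp [A, h]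
  refine ⟨Real.exp_pos q, A, ?_, fun i => ⟨?_, ?_⟩⟩
  · exact Matrix.linearIndependent_rows_iff_isUnit.2
      ((Matrix.isUnit_iff_isUnit_det A).2 (isUnit_iff_ne_zero.2 hA))
  · by_cases h : (i : ℕ) = 0
    · refine ⟨1, fun j => ⌊ξ j⌋, fun j => ?_⟩
      simp [A, h]
    · refine ⟨0, fun j => if (i : ℕ) = j then -1 else 0, fun j => ?_⟩
      by_cases hj : (j : ℕ) = 0
      · have : i ≠ j := by rintro rfl; exact h hj
        simp [A, h, hj, this]
      · by_cases hij : i = j <;> simp [A, h, hj, hij, Fin.ext_iff]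
        simp_all [Fin.ext_iff]
  · rw [mem_smul_BoxN_iff (Real.exp_pos q)]
    intro j
    have hle : |A i j| ≤ 1 := by
      simp only [A]
      split_ifs <;> simp [abs_of_nonneg, Int.fract_nonneg, (Int.fract_lt_one _).le]
    refine hle.trans ?_
    unfold boxWidth
    split_ifs
    · rw [← Real.exp_add, Real.one_le_exp_iff]
      have : (1 : ℝ) ≤ n := by exact_mod_cast hn
      nlinarith
    · rw [← Real.exp_add]; simp

/-- `n` independent lattice points have determinant at least one in absolute value. -/
lemma one_le_abs_det {n : ℕ} {ξ : ℕ → ℝ} {v : Fin n → (Fin n → ℝ)} (hv : LinearIndependent ℝ v)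
    (hm : ∀ i, v i ∈ LatticeSetN n ξ) : 1 ≤ |(Matrix.of v).det| := by
  choose x y hxy using hm
  let B : Matrix (Fin n) (Fin n) ℤ := fun i j => if (j : ℕ) = 0 then x i else y i j
  let T : Matrix (Fin n) (Fin n) ℝ := fun i j =>
    if (i : ℕ) = 0 then (if (j : ℕ) = 0 then 1 else ξ j) else if i = j then -1 else 0
  have hT : |T.det| = 1 := by
    have hT : T.BlockTriangular id := by
      intro i j hij
      have hij' : (j : ℕ) < i := hij
      have h1 : (i : ℕ) ≠ 0 := by omega
      have h2 : i ≠ j := by rintro rfl; omega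
      simp [T, h1, h2]
    rw [Matrix.det_of_isUpperTriangular hT, Finset.abs_prod]
    refine Finset.prod_eq_one fun i _ => ?_
    by_cases h : (i : ℕ) = 0 <;> simp [T, h]
  have hmul : Matrix.of v = B.map (Int.castRingHom ℝ) * T := by
    ext i j
    obtain ⟨m, rfl⟩ : ∃ m, n = m + 1 := ⟨n - 1, by have := j.2; omega⟩
    rw [Matrix.of_apply, hxy, Matrix.mul_apply, Fin.sum_univ_succ]
    have hB0 : (B.map (Int.castRingHom ℝ)) i 0 = x i := by rw [Matrix.map_apply]; simp [B]
    have hBs : ∀ k : Fin m, (B.map (Int.castRingHom ℝ)) i k.succ = y i (k + 1 : ℕ) := by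
      intro k; rw [Matrix.map_apply]; simp [B]
    simp only [hB0, hBs]
    refine Fin.cases ?_ (fun j => ?_) j
    · simp [T]
    · simp [T]
      ring
  have hdet : (Matrix.of v).det ≠ 0 := by
    have h : IsUnit (Matrix.of v) := Matrix.linearIndependent_rows_iff_isUnit.1 hv
    exact isUnit_iff_ne_zero.1 ((Matrix.isUnit_iff_isUnit_det _).1 h)
  have hB : (B.map (Int.castRingHom ℝ)).det = ((B.det : ℤ) : ℝ) := by
    rw [← RingHom.mapMatrix_apply, ← RingHom.map_det]; rfl
  rw [hmul, Matrix.det_mul, hB] at hdet ⊢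
  rw [abs_mul, hT, mul_one]
  have : B.det ≠ 0 := by
    rintro h; simp [h] at hdet
  exact_mod_cast Int.one_le_abs this

lemma one_le_factorial_mul_prod {n : ℕ} (hn : 1 ≤ n) {ξ : ℕ → ℝ} {q : ℝ} {l : Fin n → ℝ}
    {v : Fin n → (Fin n → ℝ)} (hl : ∀ i, 0 < l i) (hv : LinearIndependent ℝ v)
    (hm : ∀ i, v i ∈ LatticeSetN n ξ ∧ v i ∈ l i • BoxN n q) :
    1 ≤ (n.factorial : ℝ) * ∏ i, l i := by
  refine (one_le_abs_det hv fun i => (hm i).1).trans ?_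
  rw [Matrix.det_apply]
  refine (Finset.abs_sum_le_sum_abs _ _).trans ?_
  have hterm : ∀ σ : Equiv.Perm (Fin n),
      |Equiv.Perm.sign σ • ∏ i, Matrix.of v (σ i) i| ≤ ∏ i, l i := by
    intro σ
    have h1 : |Equiv.Perm.sign σ • ∏ i, Matrix.of v (σ i) i| = ∏ i, |v (σ i) i| := by
      rcases Int.units_eq_one_or (Equiv.Perm.sign σ) with h | h <;>
        simp [h, Finset.abs_prod]
    rw [h1]
    calc ∏ i, |v (σ i) i| ≤ ∏ i, (l (σ i) * boxWidth n q i) :=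
          Finset.prod_le_prod (fun _ _ => abs_nonneg _)
            fun i _ => (mem_smul_BoxN_iff (hl _) _).1 (hm _).2 i
      _ = ∏ i, l i := by
          rw [Finset.prod_mul_distrib, prod_boxWidth hn, mul_one, Equiv.prod_comp σ l]
  refine (Finset.sum_le_sum fun σ _ => hterm σ).trans ?_
  simp [Fintype.card_perm]

/-- Independent lattice points can be chosen to realise any list of admissible scalings. -/
lemma exists_independent_of_admissible {n : ℕ} {ξ : ℕ → ℝ} {q : ℝ} {l : ℕ → ℝ} (k : ℕ)
    (hl : ∀ i < k, l i ∈ admissible n ξ q (i + 1)) :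
    ∃ v : Fin k → (Fin n → ℝ), LinearIndependent ℝ v ∧
      ∀ i, v i ∈ LatticeSetN n ξ ∧ v i ∈ l i • BoxN n q := by
  induction k with
  | zero => exact ⟨Fin.elim0, linearIndependent_empty_type, fun i => i.elim0⟩
  | succ k ih =>
    obtain ⟨v, hv, hm⟩ := ih fun i hi => hl i (by omega)
    obtain ⟨-, u, hu, hum⟩ := hl k (by omega)
    obtain ⟨i, hi⟩ : ∃ i, u i ∉ Submodule.span ℝ (Set.range v) := by
      by_contra! h
      have h1 : Submodule.span ℝ (Set.range u) ≤ Submodule.span ℝ (Set.range v) :=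
        Submodule.span_le.2 (by rintro _ ⟨i, rfl⟩; exact h i)
      have h2 := Submodule.finrank_mono h1
      rw [finrank_span_eq_card hu, finrank_span_eq_card hv] at h2
      simp at h2
    refine ⟨Fin.snoc v (u i), linearIndependent_finSnoc.2 ⟨hv, hi⟩, fun j => ?_⟩
    refine Fin.lastCases ?_ (fun j => ?_) j
    · simpa using hum i
    · simpa using hm j

lemma exp_le_of_mem_admissible {n : ℕ} {ξ : ℕ → ℝ} {q l : ℝ} {j : ℕ} (hn : 1 ≤ n) (hq : 0 ≤ q)
    (hj : 1 ≤ j) (hl : l ∈ admissible n ξ q j) : Real.exp (-(((n : ℝ) - 1) * q)) ≤ l := by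
  obtain ⟨hl0, v, hv, hm⟩ := hl
  let k : Fin j := ⟨0, hj⟩
  obtain ⟨⟨x, y, hxy⟩, hbox⟩ := hm k
  rw [mem_smul_BoxN_iff hl0] at hbox
  have hN : 0 ≤ ((n : ℝ) - 1) * q := by
    have : (1 : ℝ) ≤ n := by exact_mod_cast hn
    exact mul_nonneg (by linarith) hq
  by_cases hx : x = 0
  · obtain ⟨i, hi⟩ := Function.ne_iff.1 (hv.ne_zero k)
    have hi0 : (i : ℕ) ≠ 0 := by
      intro h
      apply hi
      rw [hxy, if_pos h, hx]
      simp
    have h1 := hbox i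
    rw [Pi.zero_apply, hxy, if_neg hi0, hx] at hi
    rw [hxy, if_neg hi0, hx, boxWidth, if_neg hi0] at h1
    have hy : y i ≠ 0 := by rintro h; simp [h] at hi
    have hy1 : (1 : ℝ) ≤ |(y i : ℝ)| := by exact_mod_cast Int.one_le_abs hy
    have h2 : (1 : ℝ) ≤ l * Real.exp (-q) := by simpa using hy1.trans (by simpa using h1)
    have h3 : Real.exp (-q) ≤ 1 := Real.exp_le_one_iff.2 (by linarith)
    have h4 : Real.exp (-(((n : ℝ) - 1) * q)) ≤ 1 := Real.exp_le_one_iff.2 (by linarith)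
    nlinarith
  · have h1 := hbox ⟨0, hn⟩
    rw [hxy, boxWidth, if_pos rfl, if_pos rfl] at h1
    have hx1 : (1 : ℝ) ≤ |(x : ℝ)| := by exact_mod_cast Int.one_le_abs hx
    rw [Real.exp_neg, inv_le_iff_one_le_mul₀ (Real.exp_pos _)]
    linarith

lemma nonempty_admissible {n : ℕ} (ξ : ℕ → ℝ) {q : ℝ} {j : ℕ} (hn : 1 ≤ n) (hq : 0 ≤ q)
    (hj : j ≤ n) : (admissible n ξ q j).Nonempty :=
  ⟨_, admissible_anti n ξ q hj (exp_mem_admissible ξ hn hq)⟩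

lemma exp_le_lambdaMinN {n : ℕ} (ξ : ℕ → ℝ) {q : ℝ} {j : ℕ} (hq : 0 ≤ q) (hj : 1 ≤ j)
    (hjn : j ≤ n) : Real.exp (-(((n : ℝ) - 1) * q)) ≤ lambdaMinN n ξ j q :=
  le_csInf (nonempty_admissible ξ (hj.trans hjn) hq hjn)
    fun _ h => exp_le_of_mem_admissible (hj.trans hjn) hq hj h

lemma lambdaMinN_pos {n : ℕ} (ξ : ℕ → ℝ) {q : ℝ} {j : ℕ} (hq : 0 ≤ q) (hj : 1 ≤ j)
    (hjn : j ≤ n) : 0 < lambdaMinN n ξ j q :=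
  (Real.exp_pos _).trans_le (exp_le_lambdaMinN ξ hq hj hjn)

lemma le_LminN {n : ℕ} (ξ : ℕ → ℝ) {q : ℝ} {j : ℕ} (hq : 0 ≤ q) (hj : 1 ≤ j)
    (hjn : j ≤ n) : -(((n : ℝ) - 1) * q) ≤ LminN n ξ j q :=
  (Real.le_log_iff_exp_le (lambdaMinN_pos ξ hq hj hjn)).2 (exp_le_lambdaMinN ξ hq hj hjn)

lemma LminN_le_log {n : ℕ} {ξ : ℕ → ℝ} {q l : ℝ} {j : ℕ} (hq : 0 ≤ q) (hj : 1 ≤ j)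
    (hjn : j ≤ n) (hl : l ∈ admissible n ξ q j) : LminN n ξ j q ≤ Real.log l :=
  Real.log_le_log (lambdaMinN_pos ξ hq hj hjn) (csInf_le (bddBelow_admissible n ξ q j) hl)

lemma LminN_le {n : ℕ} (ξ : ℕ → ℝ) {q : ℝ} {j : ℕ} (hq : 0 ≤ q) (hj : 1 ≤ j)
    (hjn : j ≤ n) : LminN n ξ j q ≤ q := by
  simpa using LminN_le_log hq hj hjn
    (admissible_anti n ξ q hjn (exp_mem_admissible ξ (hj.trans hjn) hq))

lemma LminN_mono {n : ℕ} (ξ : ℕ → ℝ) {q : ℝ} {i j : ℕ} (hq : 0 ≤ q) (hi : 1 ≤ i) (hij : i ≤ j)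
    (hjn : j ≤ n) : LminN n ξ i q ≤ LminN n ξ j q :=
  Real.log_le_log (lambdaMinN_pos ξ hq hi (hij.trans hjn))
    (csInf_le_csInf (bddBelow_admissible n ξ q i)
      (nonempty_admissible ξ (hi.trans (hij.trans hjn)) hq hjn) (admissible_anti n ξ q hij))

/-- The lower half of Minkowski's second theorem for `LatticeSetN`. -/
lemma neg_log_le_sum_LminN {n : ℕ} (ξ : ℕ → ℝ) {q : ℝ} (hn : 1 ≤ n) (hq : 0 ≤ q) :
    -Real.log (n.factorial * 2 ^ n) ≤ ∑ i ∈ Finset.range n, LminN n ξ (i + 1) q := by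
  have hpos : ∀ i < n, 0 < lambdaMinN n ξ (i + 1) q := fun i hi =>
    lambdaMinN_pos ξ hq (by omega) (by omega)
  have hex : ∀ i : ℕ, ∃ l : ℝ, i < n →
      l ∈ admissible n ξ q (i + 1) ∧ l ≤ 2 * lambdaMinN n ξ (i + 1) q := by
    intro i
    by_cases hi : i < n
    · obtain ⟨l, hl, hlt⟩ := exists_lt_of_csInf_lt (b := 2 * lambdaMinN n ξ (i + 1) q)
        (nonempty_admissible ξ hn hq hi) (by
          have := hpos i hi
          change lambdaMinN n ξ (i + 1) q < _
          linarith)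
      exact ⟨l, fun _ => ⟨hl, hlt.le⟩⟩
    · exact ⟨0, fun h => absurd h hi⟩
  choose l hl using hex
  obtain ⟨v, hv, hm⟩ := exists_independent_of_admissible n fun i hi => (hl i hi).1
  have h1 := one_le_factorial_mul_prod hn (fun i : Fin n => (hl i i.2).1.1) hv hm
  rw [Fin.prod_univ_eq_prod_range l n] at h1
  have h2 : ∏ i ∈ Finset.range n, l i ≤ 2 ^ n * ∏ i ∈ Finset.range n, lambdaMinN n ξ (i + 1) q := by
    have : (2 : ℝ) ^ n = ∏ _i ∈ Finset.range n, 2 := by simp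
    rw [this, ← Finset.prod_mul_distrib]
    exact Finset.prod_le_prod (fun i hi => (hl i (Finset.mem_range.1 hi)).1.1.le)
      fun i hi => (hl i (Finset.mem_range.1 hi)).2
  have h3 : 1 ≤ (n.factorial * 2 ^ n : ℝ) * ∏ i ∈ Finset.range n, lambdaMinN n ξ (i + 1) q := by
    rw [mul_assoc]
    exact h1.trans (mul_le_mul_of_nonneg_left h2 (by positivity))
  have h4 := Real.log_nonneg h3
  have hP : 0 < ∏ i ∈ Finset.range n, lambdaMinN n ξ (i + 1) q :=
    Finset.prod_pos fun i hi => hpos i (Finset.mem_range.1 hi)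
  rw [Real.log_mul (by positivity) hP.ne',
    Real.log_prod fun i hi => (hpos i (Finset.mem_range.1 hi)).ne'] at h4
  unfold LminN
  linarith

lemma sum_sub_LminN_le {n : ℕ} (ξ : ℕ → ℝ) {q : ℝ} (hn : 1 ≤ n) (hq : 0 ≤ q) {s : Finset ℕ}
    (hs : s ⊆ Finset.range n) :
    ∑ i ∈ s, (q - LminN n ξ (i + 1) q) ≤ n * q + Real.log (n.factorial * 2 ^ n) := by
  refine (Finset.sum_le_sum_of_subset_of_nonneg hs fun i hi _ => ?_).trans ?_
  · have := LminN_le ξ hq (j := i + 1) (by omega) (Finset.mem_range.1 hi)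
    linarith
  · have := neg_log_le_sum_LminN ξ hn hq
    rw [Finset.sum_sub_distrib]
    simp only [Finset.sum_const, Finset.card_range, nsmul_eq_mul]
    linarith

lemma le_LminN_one_add_two {n : ℕ} (ξ : ℕ → ℝ) {q : ℝ} (hn : 2 ≤ n) (hq : 0 ≤ q) :
    -((n - 2) * q) - Real.log (n.factorial * 2 ^ n) ≤ LminN n ξ 1 q + LminN n ξ 2 q := by
  have h := sum_sub_LminN_le ξ (s := {0, 1}) (by omega : 1 ≤ n) hq
    (by intro i; simp only [Finset.mem_insert, Finset.mem_singleton, Finset.mem_range]; omega)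
  rw [Finset.sum_pair (by decide)] at h
  norm_num at h
  linarith

lemma le_LminN_one_add_two_add {n : ℕ} (ξ : ℕ → ℝ) {q : ℝ} {j : ℕ} (hq : 0 ≤ q) (hj : 3 ≤ j)
    (hjn : j ≤ n) : -((n - 3) * q) - Real.log (n.factorial * 2 ^ n) ≤
      LminN n ξ 1 q + LminN n ξ 2 q + LminN n ξ j q := by
  obtain ⟨i, rfl⟩ : ∃ i, j = i + 1 := ⟨j - 1, by omega⟩
  have h := sum_sub_LminN_le ξ (s := {0, 1, i}) (by omega : 1 ≤ n) hq
    (by intro i; simp only [Finset.mem_insert, Finset.mem_singleton, Finset.mem_range]; omega)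
  rw [Finset.sum_insert (by simp; omega), Finset.sum_pair (by omega)] at h
  norm_num at h
  linarith

/-- The term of index `t` of the series `∑ 10^{-t!}` over positive `t` congruent to `j` mod `N`. -/
noncomputable def residueTerm (N j t : ℕ) : ℝ :=
  if 1 ≤ t ∧ t ≡ j [MOD N] then ((10 : ℝ) ^ t.factorial)⁻¹ else 0

/-- `10^{s!}` times the partial sum up to index `s` of the series of `residueTerm N j`. -/
def residueNumerator (N j s : ℕ) : ℕ :=
  ∑ t ∈ Finset.range (s + 1),
    if 1 ≤ t ∧ t ≡ j [MOD N] then 10 ^ (s.factorial - t.factorial) else 0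

lemma residueTerm_nonneg (N j t : ℕ) : 0 ≤ residueTerm N j t := by
  unfold residueTerm; split_ifs <;> positivity

lemma residueTerm_add_le (N j s t : ℕ) :
    residueTerm N j (t + (s + 1)) ≤ ((10 : ℝ) ^ (s + 1).factorial)⁻¹ * (1 / 10) ^ t := by
  unfold residueTerm
  split_ifs
  · rw [one_div, inv_pow, ← mul_inv, ← pow_add]
    refine inv_anti₀ (by positivity) (pow_le_pow_right₀ (by norm_num) ?_)
    rw [add_comm]
    exact Nat.add_factorial_le_factorial_add t (by omega)
  · positivity

lemma summable_residueTerm_add (N j s : ℕ) :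
    Summable fun t => residueTerm N j (t + (s + 1)) :=
  Summable.of_nonneg_of_le (fun _ => residueTerm_nonneg _ _ _) (residueTerm_add_le N j s)
    ((summable_geometric_of_lt_one (by norm_num) (by norm_num)).mul_left _)

lemma tsum_eq_tsum_residueTerm {N j : ℕ} (hj : 1 ≤ j) (hjN : j ≤ N) :
    ∑' k : ℕ, (10 : ℝ) ^ (-((k * N + j).factorial : ℤ)) = ∑' t, residueTerm N j t := by
  have hinj : Function.Injective fun k : ℕ => k * N + j := by
    intro a b h
    exact Nat.eq_of_mul_eq_mul_right (by omega : 0 < N) (Nat.add_right_cancel h)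
  rw [← hinj.tsum_eq (f := residueTerm N j)]
  · refine tsum_congr fun k => ?_
    have h1 : 1 ≤ k * N + j := by omega
    have h2 : k * N + j ≡ j [MOD N] := by simp [Nat.ModEq]
    rw [residueTerm, if_pos ⟨h1, h2⟩, zpow_neg, zpow_natCast]
  · intro t ht
    have h : 1 ≤ t ∧ t ≡ j [MOD N] := by
      by_contra h
      exact ht (if_neg h)
    have hjt : j ≤ t := by
      by_contra hlt
      have h2 := (Nat.modEq_iff_dvd' (by omega : t ≤ j)).1 h.2
      have := Nat.le_of_dvd (by omega) h2
      omega
    obtain ⟨k, hk⟩ := (Nat.modEq_iff_dvd' hjt).1 h.2.symm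
    exact ⟨k, by simp only; rw [mul_comm, ← hk]; omega⟩

lemma residueNumerator_eq (N j s : ℕ) : (residueNumerator N j s : ℝ) =
    (10 : ℝ) ^ s.factorial * ∑ t ∈ Finset.range (s + 1), residueTerm N j t := by
  rw [residueNumerator, Finset.mul_sum, Nat.cast_sum]
  refine Finset.sum_congr rfl fun t ht => ?_
  unfold residueTerm
  split_ifs
  · have : t.factorial ≤ s.factorial :=
      Nat.factorial_le (Nat.lt_succ_iff.1 (Finset.mem_range.1 ht))
    push_cast
    rw [pow_sub₀ _ (by norm_num) this]
  · simp

lemma residueNumerator_succ {N j s : ℕ} (h : s + 1 ≡ j [MOD N]) :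
    residueNumerator N j (s + 1) =
      10 ^ ((s + 1).factorial - s.factorial) * residueNumerator N j s + 1 := by
  rw [residueNumerator, Finset.sum_range_succ, if_pos ⟨by omega, h⟩, Nat.sub_self, pow_zero,
    residueNumerator, Finset.mul_sum]
  congr 1
  refine Finset.sum_congr rfl fun t ht => ?_
  have h1 : t.factorial ≤ s.factorial :=
    Nat.factorial_le (Nat.lt_succ_iff.1 (Finset.mem_range.1 ht))
  have h2 : s.factorial ≤ (s + 1).factorial := Nat.factorial_le (by omega)
  split_ifs
  · rw [← pow_add]
    congr 1
    omega
  · simp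

lemma abs_tsum_mul_sub_residueNumerator_le (N j s : ℕ) :
    |(∑' t, residueTerm N j t) * 10 ^ s.factorial - residueNumerator N j s| ≤
      2 * 10 ^ s.factorial / 10 ^ (s + 1).factorial := by
  have hs := (summable_nat_add_iff (s + 1)).1 (summable_residueTerm_add N j s)
  have htail : ∑' t, residueTerm N j (t + (s + 1)) ≤ 2 * ((10 : ℝ) ^ (s + 1).factorial)⁻¹ := by
    refine ((summable_residueTerm_add N j s).tsum_le_tsum (residueTerm_add_le N j s)
      ((summable_geometric_of_lt_one (by norm_num) (by norm_num)).mul_left _)).trans ?_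
    rw [tsum_mul_left, tsum_geometric_of_lt_one (by norm_num) (by norm_num), mul_comm]
    gcongr
    norm_num
  have hnn : 0 ≤ ∑' t, residueTerm N j (t + (s + 1)) :=
    tsum_nonneg fun _ => residueTerm_nonneg _ _ _
  rw [residueNumerator_eq, ← hs.sum_add_tsum_nat_add (s + 1), add_mul, mul_comm, add_sub_cancel_left,
    abs_of_nonneg (by positivity)]
  calc _ ≤ 2 * ((10 : ℝ) ^ (s + 1).factorial)⁻¹ * 10 ^ s.factorial := by gcongr
    _ = _ := by ring

/-- The lattice point with first coordinate `10^{s!}` that approximates the series well. -/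
noncomputable def approxPoint (n : ℕ) (ξ : ℕ → ℝ) (s : ℕ) (i : Fin n) : ℝ :=
  if (i : ℕ) = 0 then 10 ^ s.factorial
  else ξ i * 10 ^ s.factorial - residueNumerator (n - 1) i s

/-- `ξ 1, …, ξ (n-1)` are the sums of `10^{-t!}` over the residue classes modulo `n - 1`. -/
def IsResidueTuple (n : ℕ) (ξ : ℕ → ℝ) : Prop :=
  ∀ j : ℕ, 1 ≤ j → j ≤ n - 1 → ξ j = ∑' t, residueTerm (n - 1) j t

lemma approxPoint_mem (n : ℕ) (ξ : ℕ → ℝ) (s : ℕ) : approxPoint n ξ s ∈ LatticeSetN n ξ := by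
  refine ⟨10 ^ s.factorial, fun j => residueNumerator (n - 1) j s, fun i => ?_⟩
  simp [approxPoint]

lemma approxPoint_mem_smul_BoxN {n : ℕ} {ξ : ℕ → ℝ} (hξ : IsResidueTuple n ξ) (s : ℕ) {q l : ℝ}
    (hl : 0 < l) (h1 : (10 : ℝ) ^ s.factorial ≤ l * Real.exp ((n - 1) * q))
    (h2 : 2 * (10 : ℝ) ^ s.factorial / 10 ^ (s + 1).factorial ≤ l * Real.exp (-q)) :
    approxPoint n ξ s ∈ l • BoxN n q := by
  rw [mem_smul_BoxN_iff hl]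
  intro i
  unfold approxPoint boxWidth
  split_ifs with h
  · rwa [abs_of_pos (by positivity)]
  · rw [hξ i (by omega) (by omega)]
    exact (abs_tsum_mul_sub_residueNumerator_le _ _ _).trans h2

lemma approxPoint_ne_zero {n : ℕ} (hn : 1 ≤ n) (ξ : ℕ → ℝ) (s : ℕ) : approxPoint n ξ s ≠ 0 := by
  intro h
  have := congrFun h ⟨0, hn⟩
  simp [approxPoint] at this

lemma linearIndependent_approxPoint {n : ℕ} (hn : 2 ≤ n) (ξ : ℕ → ℝ) (s : ℕ) :
    LinearIndependent ℝ ![approxPoint n ξ s, approxPoint n ξ (s + 1)] := by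
  obtain ⟨j, hj1, hjn, hj⟩ : ∃ j, 1 ≤ j ∧ j ≤ n - 1 ∧ s + 1 ≡ j [MOD (n - 1)] := by
    refine ⟨s % (n - 1) + 1, by omega, ?_, ?_⟩
    · have := Nat.mod_lt s (by omega : 0 < n - 1)
      omega
    · exact (Nat.mod_modEq s (n - 1)).symm.add_right 1
  rw [LinearIndependent.pair_iff]
  intro a b hab
  have e0 := congrFun hab ⟨0, by omega⟩
  have ej := congrFun hab ⟨j, by omega⟩
  have hj0 : j ≠ 0 := by omega
  have hQ : (10 : ℝ) ^ (s + 1).factorial =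
      10 ^ ((s + 1).factorial - s.factorial) * 10 ^ s.factorial := by
    rw [← pow_add, Nat.sub_add_cancel (Nat.factorial_le (by omega))]
  simp only [Pi.add_apply, Pi.smul_apply, smul_eq_mul, Pi.zero_apply, approxPoint, if_true,
    if_neg hj0, residueNumerator_succ hj, hQ] at e0 ej
  push_cast at ej
  have hM : a + b * 10 ^ ((s + 1).factorial - s.factorial) = 0 := by
    have : (10 : ℝ) ^ s.factorial ≠ 0 := by positivity
    apply mul_right_cancel₀ this
    linarith
  have hb : b = 0 := by
    linear_combination (ξ j * 10 ^ s.factorial - residueNumerator (n - 1) j s) * hM - ej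
  exact ⟨by simpa [hb] using hM, hb⟩

/-- `log (10^{s!})`. -/
noncomputable def logHeight (s : ℕ) : ℝ := s.factorial * Real.log 10

lemma log_two_le_logHeight (s : ℕ) : Real.log 2 ≤ logHeight s := by
  have h1 : (1 : ℝ) ≤ s.factorial := by exact_mod_cast Nat.succ_le_of_lt s.factorial_pos
  have h2 : Real.log 2 ≤ Real.log 10 := Real.log_le_log (by norm_num) (by norm_num)
  have h3 : 0 < Real.log 2 := Real.log_pos (by norm_num)
  unfold logHeight
  nlinarith

lemma logHeight_pos (s : ℕ) : 0 < logHeight s :=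
  (Real.log_pos (by norm_num)).trans_le (log_two_le_logHeight s)

lemma logHeight_succ (s : ℕ) : logHeight (s + 1) = (s + 1) * logHeight s := by
  unfold logHeight
  rw [Nat.factorial_succ]
  push_cast
  ring

lemma exp_logHeight (s : ℕ) : Real.exp (logHeight s) = 10 ^ s.factorial := by
  rw [logHeight, Real.exp_nat_mul, Real.exp_log (by norm_num)]

lemma tendsto_logHeight : Tendsto logHeight atTop atTop := by
  refine Tendsto.atTop_mul_const (Real.log_pos (by norm_num)) ?_
  exact tendsto_natCast_atTop_atTop.comp (tendsto_atTop_mono Nat.self_le_factorial tendsto_id)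

lemma logHeight_add_le {n s : ℕ} {ε q : ℝ} (hε : 0 < ε) (hs : 3 * n / ε ≤ s)
    (hq : logHeight (s + 1) ≤ n * q) : logHeight s + 2 * Real.log 2 ≤ ε * q := by
  have h1 := log_two_le_logHeight s
  have h2 := logHeight_pos s
  rw [logHeight_succ] at hq
  rw [div_le_iff₀ hε] at hs
  have hs0 : (0 : ℝ) ≤ s := by positivity
  have hn : (0 : ℝ) ≤ n := by positivity
  have hnq : 0 < (n : ℝ) * q := lt_of_lt_of_le (by positivity) hq
  have hq0 : 0 < q := pos_of_mul_pos_right hnq hn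
  have h3 : (s + 1) * (3 * logHeight s) ≤ (s + 1) * (ε * q) := by
    have := mul_le_mul_of_nonneg_right hs hq0.le
    nlinarith [mul_pos hε hq0]
  have := le_of_mul_le_mul_left h3 (by positivity)
  linarith

section Trajectories

variable {n s : ℕ} {ξ : ℕ → ℝ} {q : ℝ}

lemma approxPoint_mem_rising (hξ : IsResidueTuple n ξ) (h : logHeight (s + 1) ≤ n * q) :
    approxPoint n ξ s ∈ (2 * 10 ^ s.factorial * Real.exp (q - logHeight (s + 1))) • BoxN n q := by
  refine approxPoint_mem_smul_BoxN hξ s (by positivity) ?_ ?_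
  · rw [mul_assoc, ← Real.exp_add]
    have : 1 ≤ Real.exp (q - logHeight (s + 1) + (n - 1) * q) :=
      Real.one_le_exp (by linarith)
    have h10 : (0 : ℝ) < 10 ^ s.factorial := by positivity
    nlinarith
  · rw [mul_assoc, ← Real.exp_add, show q - logHeight (s + 1) + -q = -logHeight (s + 1) by ring,
      Real.exp_neg, exp_logHeight, div_eq_mul_inv]

lemma approxPoint_mem_falling (hξ : IsResidueTuple n ξ) (h : n * q ≤ logHeight (s + 1)) :
    approxPoint n ξ s ∈ (2 * 10 ^ s.factorial * Real.exp (-((n - 1) * q))) • BoxN n q := by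
  refine approxPoint_mem_smul_BoxN hξ s (by positivity) ?_ ?_
  · rw [mul_assoc, ← Real.exp_add, neg_add_cancel, Real.exp_zero]
    have h10 : (0 : ℝ) < 10 ^ s.factorial := by positivity
    linarith
  · rw [mul_assoc (2 * _), ← Real.exp_add, div_eq_mul_inv, ← exp_logHeight (s + 1), ← Real.exp_neg]
    gcongr
    linarith

lemma admissible_one_of_mem {l : ℝ} (hn : 1 ≤ n) (hl : 0 < l)
    (h : approxPoint n ξ s ∈ l • BoxN n q) : l ∈ admissible n ξ q 1 :=
  ⟨hl, fun _ => approxPoint n ξ s,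
    linearIndependent_unique_iff.2 (approxPoint_ne_zero hn ξ s),
    fun _ => ⟨approxPoint_mem n ξ s, h⟩⟩

lemma admissible_two_of_mem {l : ℝ} (hn : 2 ≤ n) (hl : 0 < l)
    (h : approxPoint n ξ s ∈ l • BoxN n q) (h' : approxPoint n ξ (s + 1) ∈ l • BoxN n q) :
    l ∈ admissible n ξ q 2 := by
  refine ⟨hl, _, linearIndependent_approxPoint hn ξ s, fun i => ?_⟩
  fin_cases i
  · exact ⟨approxPoint_mem n ξ s, h⟩
  · exact ⟨approxPoint_mem n ξ (s + 1), h'⟩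

lemma smul_BoxN_mono {l l' : ℝ} (hl : 0 < l) (h : l ≤ l') : l • BoxN n q ⊆ l' • BoxN n q := by
  intro v hv
  rw [mem_smul_BoxN_iff (hl.trans_le h)]
  exact fun i => ((mem_smul_BoxN_iff hl v).1 hv i).trans
    (mul_le_mul_of_nonneg_right h (boxWidth_pos n q i).le)

lemma log_scaling (s : ℕ) (x : ℝ) :
    Real.log (2 * 10 ^ s.factorial * Real.exp x) = Real.log 2 + logHeight s + x := by
  rw [Real.log_mul (by positivity) (by positivity), Real.log_mul (by norm_num) (by positivity),
    Real.log_pow, Real.log_exp, logHeight]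

lemma LminN_one_le_rising (hn : 1 ≤ n) (hq : 0 ≤ q) (hξ : IsResidueTuple n ξ)
    (h : logHeight (s + 1) ≤ n * q) :
    LminN n ξ 1 q ≤ Real.log 2 + logHeight s + (q - logHeight (s + 1)) := by
  rw [← log_scaling]
  exact LminN_le_log hq le_rfl hn
    (admissible_one_of_mem hn (by positivity) (approxPoint_mem_rising hξ h))

lemma LminN_one_le_falling (hn : 1 ≤ n) (hq : 0 ≤ q) (hξ : IsResidueTuple n ξ)
    (h : n * q ≤ logHeight (s + 1)) :
    LminN n ξ 1 q ≤ Real.log 2 + logHeight s + -((n - 1) * q) := by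
  rw [← log_scaling]
  exact LminN_le_log hq le_rfl hn
    (admissible_one_of_mem hn (by positivity) (approxPoint_mem_falling hξ h))

lemma LminN_two_le (hn : 2 ≤ n) (hq : 0 ≤ q) (hξ : IsResidueTuple n ξ)
    (h : logHeight (s + 1) ≤ n * q) (h' : n * q ≤ logHeight (s + 2)) :
    LminN n ξ 2 q ≤ max (Real.log 2 + logHeight s + (q - logHeight (s + 1)))
      (Real.log 2 + logHeight (s + 1) + -((n - 1) * q)) := by
  have hr := approxPoint_mem_rising hξ h
  have hf := approxPoint_mem_falling hξ h'
  rw [← log_scaling, ← log_scaling]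
  rcases le_total (2 * 10 ^ s.factorial * Real.exp (q - logHeight (s + 1)))
    (2 * 10 ^ (s + 1).factorial * Real.exp (-((n - 1) * q))) with hle | hle
  · exact (LminN_le_log hq (by norm_num) hn (admissible_two_of_mem hn (by positivity)
      (smul_BoxN_mono (by positivity) hle hr) hf)).trans (le_max_right _ _)
  · exact (LminN_le_log hq (by norm_num) hn (admissible_two_of_mem hn (by positivity)
      hr (smul_BoxN_mono (by positivity) hle hf))).trans (le_max_left _ _)

lemma LminN_one_add_two_le (hn : 2 ≤ n) (hq : 0 ≤ q) (hξ : IsResidueTuple n ξ)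
    (h : logHeight (s + 1) ≤ n * q) (h' : n * q ≤ logHeight (s + 2)) :
    LminN n ξ 1 q + LminN n ξ 2 q ≤ logHeight s + 2 * Real.log 2 - (n - 2) * q := by
  have h1 := LminN_one_le_rising (by omega) hq hξ h
  have h2 := LminN_one_le_falling (by omega) hq hξ h'
  rcases le_max_iff.1 (LminN_two_le hn hq hξ h h') with h3 | h3 <;> linarith

end Trajectories

lemma eventually_exists_logHeight_le {n : ℕ} (hn : 1 ≤ n) (K : ℕ) :
    ∀ᶠ q : ℝ in atTop, ∃ s ≥ K, logHeight (s + 1) ≤ n * q ∧ n * q ≤ logHeight (s + 2) := by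
  filter_upwards [eventually_ge_atTop (logHeight (K + 1)), eventually_ge_atTop 0] with q hq hq0
  have hn' : (1 : ℝ) ≤ n := by exact_mod_cast hn
  have hK : logHeight (K + 1) ≤ n * q := by nlinarith
  have hex : ∃ m, n * q < logHeight (K + 1 + m) := by
    obtain ⟨m, hm⟩ := (((tendsto_add_atTop_iff_nat (K + 1)).2 tendsto_logHeight).eventually_gt_atTop
      (n * q)).exists
    exact ⟨m, by rwa [add_comm]⟩
  classical
  have hspec := Nat.find_spec hex
  obtain ⟨m, hm⟩ : ∃ m, Nat.find hex = m + 1 := by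
    refine Nat.exists_eq_succ_of_ne_zero fun h0 => ?_
    rw [h0] at hspec
    exact absurd hspec (not_lt.2 hK)
  have hmin := Nat.find_min hex (m := m) (by omega)
  rw [hm] at hspec
  refine ⟨K + m, by omega, ?_, ?_⟩
  · have := not_lt.1 hmin
    rwa [add_right_comm] at this
  · have := hspec.le
    rwa [show K + 1 + (m + 1) = K + m + 2 by omega] at this

lemma eventually_LminN_one_add_two_le {n : ℕ} {ξ : ℕ → ℝ} (hn : 2 ≤ n) (hξ : IsResidueTuple n ξ)
    {ε : ℝ} (hε : 0 < ε) :
    ∀ᶠ q in atTop, LminN n ξ 1 q + LminN n ξ 2 q ≤ (-(n - 2) + ε) * q := by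
  filter_upwards [eventually_exists_logHeight_le (by omega : 1 ≤ n) ⌈3 * n / ε⌉₊,
    eventually_ge_atTop 0] with q ⟨s, hs, h1, h2⟩ hq
  have h3 := LminN_one_add_two_le hn hq hξ h1 h2
  have h4 := logHeight_add_le hε ((Nat.le_ceil _).trans (by exact_mod_cast hs)) h1
  linarith

lemma frequently_of_logHeight {n : ℕ} (hn : 1 ≤ n) {p : ℝ → Prop} (K : ℕ) {g : ℕ → ℝ}
    (hg : ∀ s, logHeight (s + 1) ≤ n * g s) (hp : ∀ s ≥ K, p (g s)) : ∃ᶠ q in atTop, p q := by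
  have hn' : (0 : ℝ) < n := by exact_mod_cast hn
  have ht : Tendsto g atTop atTop := by
    refine tendsto_atTop_mono (f := fun s => logHeight (s + 1) / n) (fun s => ?_)
      (((tendsto_add_atTop_iff_nat 1).2 tendsto_logHeight).atTop_div_const hn')
    rw [div_le_iff₀ hn', mul_comm]
    exact hg s
  exact ht.frequently ((eventually_ge_atTop K).mono hp).frequently

lemma logHeight_le_succ (s : ℕ) : logHeight s ≤ logHeight (s + 1) := by
  rw [logHeight_succ]
  nlinarith [logHeight_pos s, Nat.cast_nonneg (α := ℝ) s]

lemma frequently_LminN_one_le {n : ℕ} {ξ : ℕ → ℝ} (hn : 1 ≤ n) (hξ : IsResidueTuple n ξ)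
    {ε : ℝ} (hε : 0 < ε) : ∃ᶠ q in atTop, LminN n ξ 1 q ≤ (-(n - 1) + ε) * q := by
  have hn' : (0 : ℝ) < n := by exact_mod_cast hn
  refine frequently_of_logHeight hn ⌈3 * n / ε⌉₊ (g := fun s => logHeight (s + 1) / n)
    (fun s => (mul_div_cancel₀ _ hn'.ne').ge) fun s hs => ?_
  have heq : n * (logHeight (s + 1) / n) = logHeight (s + 1) := mul_div_cancel₀ _ hn'.ne'
  have hq : 0 ≤ logHeight (s + 1) / n := (div_pos (logHeight_pos _) hn').le
  have h3 := LminN_one_le_rising hn hq hξ heq.ge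
  have h4 := logHeight_add_le hε ((Nat.le_ceil _).trans (by exact_mod_cast hs)) heq.ge
  have h5 : 0 < Real.log 2 := Real.log_pos (by norm_num)
  linarith

lemma frequently_LminN_two_le {n : ℕ} {ξ : ℕ → ℝ} (hn : 2 ≤ n) (hξ : IsResidueTuple n ξ)
    {ε : ℝ} (hε : 0 < ε) : ∃ᶠ q in atTop, LminN n ξ 2 q ≤ ((2 - n) / 2 + ε) * q := by
  have hn' : (0 : ℝ) < n := by positivity
  have heq : ∀ s, n * ((2 * logHeight (s + 1) - logHeight s) / n) =
      2 * logHeight (s + 1) - logHeight s := fun s => mul_div_cancel₀ _ hn'.ne'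
  have hle : ∀ s, logHeight (s + 1) ≤ n * ((2 * logHeight (s + 1) - logHeight s) / n) := by
    intro s
    rw [heq]
    linarith [logHeight_le_succ s]
  refine frequently_of_logHeight (by omega) ⌈3 * n / ε⌉₊ hle fun s hs => ?_
  have hq : 0 ≤ (2 * logHeight (s + 1) - logHeight s) / n :=
    div_nonneg (by linarith [logHeight_le_succ s, logHeight_pos (s + 1)]) hn'.le
  have h2 : n * ((2 * logHeight (s + 1) - logHeight s) / n) ≤ logHeight (s + 2) := by
    rw [heq, logHeight_succ (s + 1)]
    push_cast
    nlinarith [logHeight_pos s, logHeight_pos (s + 1), Nat.cast_nonneg (α := ℝ) s]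
  have h4 := logHeight_add_le hε ((Nat.le_ceil _).trans (by exact_mod_cast hs)) (hle s)
  have h5 : 0 < Real.log 2 := Real.log_pos (by norm_num)
  have h6 := heq s
  have h7 := logHeight_pos s
  rcases le_max_iff.1 (LminN_two_le hn hq hξ (hle s) h2) with h3 | h3 <;> linarith

lemma isBoundedUnder_LminN_div {n : ℕ} (ξ : ℕ → ℝ) {j : ℕ} (hj : 1 ≤ j) (hjn : j ≤ n) :
    (atTop.IsBoundedUnder (· ≤ ·) fun q => LminN n ξ j q / q) ∧
      atTop.IsBoundedUnder (· ≥ ·) fun q => LminN n ξ j q / q := by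
  refine ⟨⟨1, ?_⟩, ⟨-((n : ℝ) - 1), ?_⟩⟩ <;> rw [eventually_map] <;>
    filter_upwards [eventually_gt_atTop 0] with q hq
  · rw [div_le_iff₀ hq, one_mul]
    exact LminN_le ξ hq.le hj hjn
  · rw [ge_iff_le, le_div_iff₀ hq, neg_mul]
    exact le_LminN ξ hq.le hj hjn

lemma phiLowN_eq {n : ℕ} {ξ : ℕ → ℝ} {j : ℕ} {c : ℝ} (hj : 1 ≤ j) (hjn : j ≤ n)
    (hge : ∀ ε > 0, ∀ᶠ q in atTop, (c - ε) * q ≤ LminN n ξ j q)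
    (hle : ∀ ε > 0, ∃ᶠ q in atTop, LminN n ξ j q ≤ (c + ε) * q) : phiLowN n ξ j = c := by
  obtain ⟨hB, hb⟩ := isBoundedUnder_LminN_div ξ hj hjn
  apply le_antisymm
  · refine (liminf_le_iff hB.isCoboundedUnder_ge hb).2 fun y hy => ?_
    refine ((hle ((y - c) / 2) (by linarith)).and_eventually (eventually_gt_atTop 0)).mono ?_
    rintro q ⟨h, hq⟩
    rw [div_lt_iff₀ hq]
    nlinarith
  · refine (le_liminf_iff hB.isCoboundedUnder_ge hb).2 fun y hy => ?_
    filter_upwards [hge ((c - y) / 2) (by linarith), eventually_gt_atTop 0] with q h hq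
    rw [lt_div_iff₀ hq]
    nlinarith

lemma phiUpN_eq {n : ℕ} {ξ : ℕ → ℝ} {j : ℕ} {c : ℝ} (hj : 1 ≤ j) (hjn : j ≤ n)
    (hge : ∀ ε > 0, ∃ᶠ q in atTop, (c - ε) * q ≤ LminN n ξ j q)
    (hle : ∀ ε > 0, ∀ᶠ q in atTop, LminN n ξ j q ≤ (c + ε) * q) : phiUpN n ξ j = c := by
  obtain ⟨hB, hb⟩ := isBoundedUnder_LminN_div ξ hj hjn
  apply le_antisymm
  · refine (limsup_le_iff hb.isCoboundedUnder_le hB).2 fun y hy => ?_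
    filter_upwards [hle ((y - c) / 2) (by linarith), eventually_gt_atTop 0] with q h hq
    rw [div_lt_iff₀ hq]
    nlinarith
  · refine (le_limsup_iff hb.isCoboundedUnder_le hB).2 fun y hy => ?_
    refine ((hge ((c - y) / 2) (by linarith)).and_eventually (eventually_gt_atTop 0)).mono ?_
    rintro q ⟨h, hq⟩
    rw [lt_div_iff₀ hq]
    nlinarith

lemma eventually_const_le_mul (C : ℝ) {ε : ℝ} (hε : 0 < ε) : ∀ᶠ q in atTop, C ≤ ε * q :=
  (tendsto_id.const_mul_atTop hε).eventually_ge_atTop C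

/-- Let `n ≥ 3` and `ξ_j = Σ_{k≥0} 10^{-(k(n-1)+j)!}` for `1 ≤ j ≤ n-1`. Then
`φ̲₁ = -(n-1)`, `φ̲₂ = (2-n)/2`, `φ̲_j = 1` for `3 ≤ j ≤ n`, `φ̄₁ = (2-n)/2`,
and `φ̄_j = 1` for `2 ≤ j ≤ n`. -/
theorem phi_of_explicit_tuple (n : ℕ) (hn : 3 ≤ n) (ξ : ℕ → ℝ)
    (hξ : ∀ j : ℕ, 1 ≤ j → j ≤ n - 1 →
      ξ j = ∑' k : ℕ, (10 : ℝ) ^ (-((k * (n - 1) + j).factorial : ℤ))) :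
    phiLowN n ξ 1 = -((n : ℝ) - 1) ∧
    phiLowN n ξ 2 = (2 - (n : ℝ)) / 2 ∧
    (∀ j : ℕ, 3 ≤ j → j ≤ n → phiLowN n ξ j = 1) ∧
    phiUpN n ξ 1 = (2 - (n : ℝ)) / 2 ∧
    (∀ j : ℕ, 2 ≤ j → j ≤ n → phiUpN n ξ j = 1) := by
  have hres : IsResidueTuple n ξ := fun j h1 h2 => by
    rw [hξ j h1 h2, tsum_eq_tsum_residueTerm h1 h2]
  have hpair : ∀ ε > 0, ∀ᶠ q in atTop,
      (-((n : ℝ) - 2) - ε) * q ≤ LminN n ξ 1 q + LminN n ξ 2 q := by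
    intro ε hε
    filter_upwards [eventually_const_le_mul (Real.log (n.factorial * 2 ^ n)) hε,
      eventually_ge_atTop 0] with q h hq
    linarith [le_LminN_one_add_two ξ (by omega : 2 ≤ n) hq]
  have htwo : ∀ ε > 0, ∃ᶠ q in atTop, (1 - ε) * q ≤ LminN n ξ 2 q := by
    intro ε hε
    refine ((frequently_LminN_one_le (by omega) hres (half_pos hε)).and_eventually
      (hpair _ (half_pos hε))).mono fun q ⟨h1, h2⟩ => ?_
    linarith
  refine ⟨phiLowN_eq le_rfl (by omega) ?_ ?_, phiLowN_eq (by norm_num) (by omega) ?_ ?_,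
    fun j hj hjn => phiLowN_eq (by omega) hjn ?_ ?_, phiUpN_eq le_rfl (by omega) ?_ ?_,
    fun j hj hjn => phiUpN_eq (by omega) hjn ?_ ?_⟩ <;> intro ε hε
  · filter_upwards [eventually_ge_atTop 0] with q hq
    have := le_LminN ξ hq le_rfl (by omega : 1 ≤ n)
    nlinarith
  · exact frequently_LminN_one_le (by omega) hres hε
  · filter_upwards [hpair ε hε, eventually_ge_atTop 0] with q h hq
    have := LminN_mono ξ hq le_rfl one_le_two (by omega : 2 ≤ n)
    nlinarith
  · exact frequently_LminN_two_le (by omega) hres hε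
  · filter_upwards [eventually_LminN_one_add_two_le (by omega) hres (half_pos hε),
      eventually_const_le_mul (Real.log (n.factorial * 2 ^ n)) (half_pos hε),
      eventually_ge_atTop 0] with q h h' hq
    linarith [le_LminN_one_add_two_add ξ hq hj hjn]
  · refine ((eventually_ge_atTop 0).mono fun q hq => ?_).frequently
    have := LminN_le ξ hq (by omega : 1 ≤ j) hjn
    nlinarith
  · refine ((frequently_LminN_two_le (by omega) hres (half_pos hε)).and_eventually
      (hpair _ (half_pos hε))).mono fun q ⟨h1, h2⟩ => ?_
    linarith
  · filter_upwards [eventually_LminN_one_add_two_le (by omega) hres hε,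
      eventually_ge_atTop 0] with q h hq
    have := LminN_mono ξ hq le_rfl one_le_two (by omega : 2 ≤ n)
    nlinarith
  · refine ((htwo ε hε).and_eventually (eventually_ge_atTop 0)).mono fun q ⟨h, hq⟩ => ?_
    exact h.trans (LminN_mono ξ hq (by norm_num) hj hjn)
  · filter_upwards [eventually_ge_atTop 0] with q hq
    have := LminN_le ξ hq (by omega : 1 ≤ j) hjn
    nlinarith
end
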